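/- arXiv:2207.09591 — 6 statements merged into one kernel-verified Lean document; each statement's English description precedes it below -/
import Mathlib

section
/- (Unit series.) For each i ∈ S, the numerical series Σ_{n≥0} |Φ_n(z_i)|² / ⟨Φ_n,Φ_n⟩ converges and its sum equals D_i. -/
open MeasureTheory Filter Topology

noncomputable section

/-- Data of a Sturm–Liouville problem with (possibly) eigenvalue-dependent
boundary conditions on `[z1, z2]`. -/
structure SLP where
  z1 : ℝ
  z2 : ℝ
  hz : z1 < z2
  p : ℝ → ℝ
  q : ℝ → ℝ
  r : ℝ → ℝ
  a : Fin 2 → ℝ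
  b : Fin 2 → ℝ
  c : Fin 2 → ℝ
  d : Fin 2 → ℝ
  hp : ContDiff ℝ 2 p
  hr : ContDiff ℝ 2 r
  hq : Continuous q
  hppos : ∀ z ∈ Set.Icc z1 z2, 0 < p z
  hrpos : ∀ z ∈ Set.Icc z1 z2, 0 < r z
  hab : ∀ j : Fin 2, (a j, b j) ≠ (0, 0)

namespace SLP

variable (P : SLP)

/-- The two boundary points: `zb 0 = z1`, `zb 1 = z2`. -/
def zb : Fin 2 → ℝ := ![P.z1, P.z2]

/-- The sign `(−1)^{j+1}` (for the boundary labelled `j+1`, here `j : Fin 2`). -/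
def sgn (_P : SLP) (j : Fin 2) : ℝ := (-1 : ℝ) ^ (j : ℕ)

/-- `j ∈ S`: the boundary condition at `zb j` is λ-dependent. -/
def inS (j : Fin 2) : Prop := (P.c j, P.d j) ≠ (0, 0)

instance (j : Fin 2) : Decidable (P.inS j) := by unfold inS; infer_instance

/-- The set `S` of λ-dependent boundaries, as a finset. -/
def Sfin : Finset (Fin 2) := Finset.univ.filter fun j => P.inS j

/-- The boundary parameter `D_j = (−1)^{j+1}(a_j d_j − b_j c_j)`. -/
def D (j : Fin 2) : ℝ := P.sgn j * (P.a j * P.d j - P.b j * P.c j)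

/-- `B_j φ = a_j φ(z_j) − b_j p(z_j) φ′(z_j)`. -/
def Bop (j : Fin 2) (φ : ℝ → ℂ) : ℂ :=
  (P.a j : ℂ) * φ (P.zb j) - (P.b j : ℂ) * ((P.p (P.zb j) : ℂ) * deriv φ (P.zb j))

/-- `C_j φ = c_j φ(z_j) − d_j p(z_j) φ′(z_j)`. -/
def Cop (j : Fin 2) (φ : ℝ → ℂ) : ℂ :=
  (P.c j : ℂ) * φ (P.zb j) - (P.d j : ℂ) * ((P.p (P.zb j) : ℂ) * deriv φ (P.zb j))

/-- The function `Φ` associated to `φ`: equal to `φ` away from λ-dependent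
boundary points, and equal to `C_j φ` at `zb j` for `j ∈ S`. -/
def assoc (φ : ℝ → ℂ) : ℝ → ℂ := fun z =>
  if P.inS 0 ∧ z = P.zb 0 then P.Cop 0 φ
  else if P.inS 1 ∧ z = P.zb 1 then P.Cop 1 φ
  else φ z

/-- The (possibly indefinite) inner product
`⟨F,G⟩ = ∫ conj(F) G r dz + Σ_{j∈S} D_j⁻¹ conj(F(z_j)) G(z_j)`. -/
def inp (F G : ℝ → ℂ) : ℂ :=
  (∫ z in P.z1..P.z2, (starRingEnd ℂ) (F z) * G z * (P.r z : ℂ)) +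
    ∑ j ∈ P.Sfin, ((P.D j : ℂ))⁻¹ * (starRingEnd ℂ) (F (P.zb j)) * G (P.zb j)

/-- `(λ, φ)` is an eigenpair of the problem. -/
def IsEigenpair (lam : ℂ) (φ : ℝ → ℂ) : Prop :=
  ContDiff ℝ 2 φ ∧
  (∃ z ∈ Set.Icc P.z1 P.z2, φ z ≠ 0) ∧
  (∀ z ∈ Set.Ioo P.z1 P.z2,
    -(deriv (fun w => (P.p w : ℂ) * deriv φ w) z) + (P.q z : ℂ) * φ z
      = lam * ((P.r z : ℂ) * φ z)) ∧
  (∀ j : Fin 2, -(P.Bop j φ) = lam * P.Cop j φ)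

/-- `λ` is an eigenvalue of the problem. -/
def IsEigenvalue (lam : ℂ) : Prop := ∃ φ, P.IsEigenpair lam φ

/-- Right-definiteness: `D_j > 0` for every `j ∈ S` (together with `r > 0`,
which is part of the standing assumptions). -/
def RightDefinite : Prop := ∀ j : Fin 2, P.inS j → 0 < P.D j

/-- Left-definiteness sign conditions. -/
def LeftDefinite : Prop :=
  (∀ z ∈ Set.Icc P.z1 P.z2, 0 ≤ P.q z) ∧
  (∀ j : Fin 2, P.inS j →
    P.a j * P.c j / P.D j ≤ 0 ∧ P.b j * P.d j / P.D j ≤ 0 ∧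
      0 ≤ (-P.sgn j) * (P.a j * P.d j) / P.D j) ∧
  (∀ j : Fin 2, ¬ P.inS j → P.b j = 0 ∨ 0 ≤ P.sgn j * P.a j / P.b j)

/-- The measure `μ = r(z) dz + Σ_{j∈S} D_j⁻¹ δ_{z_j}` on `[z1,z2]`
(right-definite case, where `D_j > 0`). -/
def muM : Measure ℝ :=
  (volume.restrict (Set.Icc P.z1 P.z2)).withDensity (fun z => ENNReal.ofReal (P.r z)) +
    ∑ j ∈ P.Sfin, (ENNReal.ofReal (P.D j)⁻¹) • Measure.dirac (P.zb j)

/-- The positive measure `μ̃ = r(z) dz + Σ_{j∈S} |D_j|⁻¹ δ_{z_j}` on `[z1,z2]`. -/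
def muAbs : Measure ℝ :=
  (volume.restrict (Set.Icc P.z1 P.z2)).withDensity (fun z => ENNReal.ofReal (P.r z)) +
    ∑ j ∈ P.Sfin, (ENNReal.ofReal |P.D j|⁻¹) • Measure.dirac (P.zb j)

/-- The weighted interior measure `r(z) dz` on `[z1,z2]`. -/
def muInt : Measure ℝ :=
  (volume.restrict (Set.Icc P.z1 P.z2)).withDensity (fun z => ENNReal.ofReal (P.r z))

end SLP

/-- A function which is differentiable near `c` except at `c`, with vanishing residue-type limit,
can be redefined at `c` so as to be differentiable there. -/
theorem differentiableAt_update_limUnder {h : ℂ → ℂ} {c : ℂ}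
    (hd : ∀ᶠ z in 𝓝[≠] c, DifferentiableAt ℂ h z)
    (hl : Tendsto (fun z => (z - c) * h z) (𝓝[≠] c) (𝓝 0)) :
    DifferentiableAt ℂ (Function.update h c (limUnder (𝓝[≠] c) h)) c := by
  rw [eventually_nhdsWithin_iff] at hd
  have hd' : DifferentiableOn ℂ h ({z | z ≠ c → DifferentiableAt ℂ h z} \ {c}) := fun z hz =>
    (hz.1 hz.2).differentiableWithinAt
  refine (Complex.differentiableOn_update_limUnder_of_isLittleO hd hd' ?_).differentiableAt hd
  have hne : ∀ᶠ z in 𝓝[≠] c, (z - c)⁻¹ = 0 → h z - h c = 0 := by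
    filter_upwards [self_mem_nhdsWithin] with z hz h0
    exact absurd (inv_eq_zero.1 h0) (sub_ne_zero.2 hz)
  rw [Asymptotics.isLittleO_iff_tendsto' hne]
  have h2 : Tendsto (fun z : ℂ => (z - c) * h c) (𝓝[≠] c) (𝓝 0) := by
    have : ContinuousAt (fun z : ℂ => (z - c) * h c) c := by fun_prop
    simpa using this.tendsto.mono_left nhdsWithin_le_nhds
  have h3 := hl.sub h2
  rw [sub_zero] at h3
  refine h3.congr fun z => ?_
  rw [div_inv_eq_mul]
  ring

/-- Residue theorem on a disc for finitely many simple poles. -/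
theorem circleIntegral_eq_sum_of_simple_poles {R : ℝ} (hR : 0 < R) {h : ℂ → ℂ} {S : Finset ℂ}
    {ρ : ℂ → ℂ} (hS : ∀ s ∈ S, s ∈ Metric.ball (0 : ℂ) R)
    (hd : ∀ z ∈ Metric.closedBall (0 : ℂ) R, z ∉ S → DifferentiableAt ℂ h z)
    (hl : ∀ s ∈ S, Tendsto (fun z => (z - s) * h z) (𝓝[≠] s) (𝓝 (ρ s))) :
    (∮ z in C(0, R), h z) = 2 * Real.pi * Complex.I * ∑ s ∈ S, ρ s := by
  classical
  set g : ℂ → ℂ := fun z => h z - ∑ s ∈ S, ρ s * (z - s)⁻¹ with hg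
  have hgd : ∀ z ∈ Metric.closedBall (0 : ℂ) R, z ∉ S → DifferentiableAt ℂ g z := by
    intro z hz hzS
    refine (hd z hz hzS).sub (DifferentiableAt.fun_sum fun s hs => ?_)
    refine DifferentiableAt.const_mul (DifferentiableAt.inv (by fun_prop) ?_) _
    exact sub_ne_zero.2 fun h => hzS (h ▸ hs)
  have hevS : ∀ z : ℂ, ∀ᶠ w in 𝓝[≠] z, w ∉ S := by
    intro z
    have : ((S.erase z : Finset ℂ) : Set ℂ)ᶜ ∈ 𝓝 z :=
      (S.erase z).finite_toSet.isClosed.isOpen_compl.mem_nhds (by simp)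
    filter_upwards [nhdsWithin_le_nhds this, self_mem_nhdsWithin] with w hw hwz hwS
    exact hw (by simpa using ⟨hwS, hwz⟩)
  have hev : ∀ s ∈ S, ∀ᶠ z in 𝓝[≠] s, DifferentiableAt ℂ g z := by
    intro s hs
    have hb : Metric.ball (0 : ℂ) R ∈ 𝓝 s := Metric.isOpen_ball.mem_nhds (hS s hs)
    filter_upwards [nhdsWithin_le_nhds hb, hevS s] with z hz hzS
    exact hgd z (Metric.ball_subset_closedBall hz) hzS
  have hgl : ∀ s ∈ S, Tendsto (fun z => (z - s) * g z) (𝓝[≠] s) (𝓝 0) := by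
    intro s hs
    have h1 : Tendsto (fun z => (z - s) * ∑ t ∈ S.erase s, ρ t * (z - t)⁻¹) (𝓝[≠] s) (𝓝 0) := by
      have : ContinuousAt (fun z => (z - s) * ∑ t ∈ S.erase s, ρ t * (z - t)⁻¹) s := by
        refine ContinuousAt.mul (by fun_prop) (tendsto_finsetSum _ fun t ht => ?_)
        refine ContinuousAt.mul (by fun_prop) (ContinuousAt.inv₀ (by fun_prop) ?_)
        exact sub_ne_zero.2 (Finset.ne_of_mem_erase ht).symm
      simpa using this.tendsto.mono_left nhdsWithin_le_nhds
    have h2 := ((hl s hs).sub_const (ρ s)).sub h1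
    simp only [sub_self] at h2
    refine h2.congr' ?_
    filter_upwards [self_mem_nhdsWithin] with z hz
    have hz' : z - s ≠ 0 := sub_ne_zero.2 hz
    rw [hg]
    simp only
    rw [← Finset.add_sum_erase _ _ hs]
    field_simp
    ring
  set G : ℂ → ℂ := fun z => if z ∈ S then limUnder (𝓝[≠] z) g else g z with hG
  have hGd : ∀ z ∈ Metric.closedBall (0 : ℂ) R, DifferentiableAt ℂ G z := by
    intro z hz
    by_cases hzS : z ∈ S
    · refine (differentiableAt_update_limUnder (hev z hzS) (hgl z hzS)).congr_of_eventuallyEq ?_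
      have := hevS z
      rw [eventually_nhdsWithin_iff] at this
      filter_upwards [this] with w hw
      by_cases hwz : w = z
      · subst hwz; simp [hG, hzS]
      · simp [hG, hwz, hw hwz]
    · refine (hgd z hz hzS).congr_of_eventuallyEq ?_
      have : (S : Set ℂ)ᶜ ∈ 𝓝 z := S.finite_toSet.isClosed.isOpen_compl.mem_nhds (by simpa using hzS)
      filter_upwards [this] with w hw
      have hw' : w ∉ S := by simpa using hw
      simp [hG, hw']
  have hG0 : (∮ z in C(0, R), G z) = 0 :=
    Complex.circleIntegral_eq_zero_of_differentiable_on_off_countable hR.le Set.countable_empty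
      (fun z hz => (hGd z hz).continuousAt.continuousWithinAt)
      (fun z hz => hGd z (Metric.ball_subset_closedBall hz.1))
  have hsph : ∀ z ∈ Metric.sphere (0 : ℂ) R, z ∉ S := by
    intro z hz hzS
    have h1 := hS z hzS
    simp only [mem_sphere_zero_iff_norm, mem_ball_zero_iff] at hz h1
    exact absurd hz h1.ne
  have hGg : (∮ z in C(0, R), G z) = ∮ z in C(0, R), g z :=
    circleIntegral.integral_congr hR.le fun z hz => by simp [hG, hsph z hz]
  have hci : ∀ s ∈ S, CircleIntegrable (fun z => ρ s * (z - s)⁻¹) 0 R := by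
    intro s hs
    refine ContinuousOn.circleIntegrable hR.le ?_
    refine ContinuousOn.mul continuousOn_const (ContinuousOn.inv₀ (by fun_prop) ?_)
    exact fun z hz => sub_ne_zero.2 fun h => hsph z hz (h ▸ hs)
  have hch : CircleIntegrable h 0 R := ContinuousOn.circleIntegrable hR.le fun z hz =>
    (hd z (Metric.sphere_subset_closedBall hz) (hsph z hz)).continuousAt.continuousWithinAt
  rw [hG0] at hGg
  have hsum : (∮ z in C(0, R), ∑ s ∈ S, ρ s * (z - s)⁻¹) =
      ∑ s ∈ S, ∮ z in C(0, R), ρ s * (z - s)⁻¹ := circleIntegral.integral_fun_sum hci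
  rw [hg, circleIntegral.integral_sub hch (CircleIntegrable.fun_sum S hci), hsum, eq_comm,
    sub_eq_zero] at hGg
  rw [hGg, Finset.mul_sum]
  refine Finset.sum_congr rfl fun s hs => ?_
  rw [circleIntegral.integral_const_mul, circleIntegral.integral_sub_inv_of_mem_ball (hS s hs)]
  ring

/-- A regular summation method with eventually nonnegative terms sums the series itself. -/
theorem tendsto_sum_range_of_weighted {a : ℕ → ℝ} {w : ℕ → ℕ → ℝ} {L : ℝ}
    (ha : ∀ᶠ n in atTop, 0 ≤ a n) (hw0 : ∀ᶠ N in atTop, ∀ n ≤ N, 0 ≤ w N n)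
    (hw1 : ∀ᶠ N in atTop, ∀ n ≤ N, w N n ≤ 1) (hw : ∀ n, Tendsto (fun N => w N n) atTop (𝓝 1))
    (hL : Tendsto (fun N => ∑ n ∈ Finset.range (N + 1), a n * w N n) atTop (𝓝 L)) :
    Tendsto (fun N => ∑ n ∈ Finset.range N, a n) atTop (𝓝 L) := by
  obtain ⟨n₀, hn₀⟩ := eventually_atTop.1 ha
  have hle : ∀ M, ∑ n ∈ Finset.range M, a (n + n₀) ≤ L - ∑ n ∈ Finset.range n₀, a n := by
    intro M
    have h1 : Tendsto (fun N => ∑ n ∈ Finset.range M, a (n + n₀) * w N (n + n₀)) atTop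
        (𝓝 (∑ n ∈ Finset.range M, a (n + n₀))) := by
      simpa using tendsto_finsetSum (Finset.range M)
        fun n _ => (hw (n + n₀)).const_mul (a (n + n₀))
    have h2 : Tendsto (fun N => ∑ n ∈ Finset.range n₀, a n * w N n) atTop
        (𝓝 (∑ n ∈ Finset.range n₀, a n)) := by
      simpa using tendsto_finsetSum (Finset.range n₀) fun n _ => (hw n).const_mul (a n)
    refine le_of_tendsto_of_tendsto h1 (hL.sub h2) ?_
    filter_upwards [hw0, eventually_ge_atTop (M + n₀)] with N hN hNM
    rw [le_sub_iff_add_le, add_comm]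
    have : ∑ n ∈ Finset.range M, a (n + n₀) * w N (n + n₀) =
        ∑ n ∈ Finset.Ico n₀ (M + n₀), a n * w N n := by
      rw [Finset.sum_Ico_eq_sum_range]
      simp [add_comm]
    rw [this, Finset.sum_range_add_sum_Ico _ (by omega)]
    refine Finset.sum_le_sum_of_subset_of_nonneg ?_ fun n hn hn' => ?_
    · exact Finset.range_mono (by omega)
    · simp only [Finset.mem_range] at hn hn'
      exact mul_nonneg (hn₀ n (by omega)) (hN n (by omega))
  have hsum : Summable a := by
    rw [← summable_nat_add_iff n₀]
    exact summable_of_sum_range_le (fun n => hn₀ _ (by omega)) hle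
  have hT : Tendsto (fun N => ∑' n, if n ≤ N then a n * w N n else 0) atTop (𝓝 (∑' n, a n)) := by
    refine tendsto_tsum_of_dominated_convergence hsum.abs (fun n => ?_) ?_
    · have := (hw n).const_mul (a n)
      rw [mul_one] at this
      refine this.congr' ?_
      filter_upwards [eventually_ge_atTop n] with N hN
      simp [hN]
    · filter_upwards [hw0, hw1] with N h0 h1 n
      split_ifs with hn
      · rw [norm_mul, Real.norm_eq_abs, Real.norm_eq_abs, abs_of_nonneg (h0 n hn)]
        exact mul_le_of_le_one_right (abs_nonneg _) (h1 n hn)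
      · simp
  have heq : ∀ N, (∑' n, if n ≤ N then a n * w N n else 0) =
      ∑ n ∈ Finset.range (N + 1), a n * w N n := by
    intro N
    rw [tsum_eq_sum (s := Finset.range (N + 1)) fun n hn => if_neg (by simpa using hn)]
    exact Finset.sum_congr rfl fun n hn => if_pos (by simpa [Nat.lt_succ_iff] using hn)
  simp only [heq] at hT
  rw [tendsto_nhds_unique hL hT]
  exact hsum.hasSum.tendsto_sum_nat

theorem integral_one_sub_exp_two_mul :
    (∫ θ in (0 : ℝ)..2 * Real.pi, (1 - Complex.exp ((θ : ℂ) * Complex.I) ^ 2 : ℂ)) =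
      (2 * Real.pi : ℂ) := by
  have h : (∫ θ in (0 : ℝ)..2 * Real.pi, Complex.exp (2 * Complex.I * θ)) = 0 := by
    rw [integral_exp_mul_complex (by simp)]
    have : Complex.exp (2 * Complex.I * (2 * Real.pi : ℝ)) = 1 := by
      rw [Complex.exp_eq_one_iff]
      exact ⟨2, by push_cast; ring⟩
    rw [this]
    simp
  have h2 : ∀ θ : ℝ, Complex.exp (θ * Complex.I) ^ 2 = Complex.exp (2 * Complex.I * θ) := by
    intro θ
    rw [← Complex.exp_nat_mul]
    congr 1
    push_cast
    ring
  simp only [h2]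
  rw [intervalIntegral.integral_sub (f := fun _ => (1 : ℂ))
    (g := fun θ : ℝ => Complex.exp (2 * Complex.I * θ)) (by simp)
    (Continuous.intervalIntegrable (by fun_prop) _ _), h]
  simp

theorem norm_one_sub_exp_sq (θ : ℝ) :
    ‖1 - Complex.exp (θ * Complex.I) ^ 2‖ = 2 * |Real.sin θ| := by
  have h : 1 - Complex.exp (θ * Complex.I) ^ 2 =
      Complex.exp (θ * Complex.I) * (-2 * Complex.I * (Real.sin θ : ℂ)) := by
    have h1 := Complex.cos_sq_add_sin_sq (θ : ℂ)
    rw [Complex.exp_mul_I]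
    push_cast
    linear_combination (-1 : ℂ) * h1 - (2 * Complex.sin θ ^ 2 - Complex.sin θ ^ 2) * Complex.I_sq
      + 2 * Complex.sin θ ^ 2 * Complex.I_sq
  rw [h, norm_mul, Complex.norm_exp_ofReal_mul_I, one_mul]
  rw [norm_mul, Complex.norm_real, Real.norm_eq_abs]
  simp

/-- Sum of the residues of a meromorphic function with simple real poles `lam n` and
resolvent-like growth. -/
theorem tendsto_sum_of_resolvent_bound {f : ℂ → ℂ} {a lam : ℕ → ℝ} {L C R₀ : ℝ}
    (hmono : StrictMono lam) (htop : Tendsto lam atTop atTop)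
    (hd : ∀ z : ℂ, (∀ n, z ≠ lam n) → DifferentiableAt ℂ f z)
    (hres : ∀ n, Tendsto (fun z => (z - lam n) * f z) (𝓝[≠] (lam n : ℂ)) (𝓝 (-(a n : ℂ))))
    (hbd : ∀ z : ℂ, R₀ ≤ ‖z‖ → z.im ≠ 0 → ‖f z‖ ≤ C / |z.im|)
    (hray : ∀ θ : ℝ, Real.sin θ ≠ 0 →
      Tendsto (fun R : ℝ => -(circleMap 0 R θ) * f (circleMap 0 R θ)) atTop (𝓝 (L : ℂ)))
    (hpos : ∀ᶠ n in atTop, 0 ≤ a n) :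
    Tendsto (fun N => ∑ n ∈ Finset.range N, a n) atTop (𝓝 L) := by
  set R : ℕ → ℝ := fun N => (lam N + lam (N + 1)) / 2 with hRdef
  have hlamR : ∀ N, lam N < R N := fun N => by
    have := hmono (Nat.lt_succ_self N)
    simp only [hRdef, Nat.succ_eq_add_one] at this ⊢
    linarith
  have hRlam : ∀ N, R N < lam (N + 1) := fun N => by
    have := hmono (Nat.lt_succ_self N)
    simp only [hRdef, Nat.succ_eq_add_one] at this ⊢
    linarith
  have hRtop : Tendsto R atTop atTop := tendsto_atTop_mono (fun N => (hlamR N).le) htop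
  have hbig : ∀ᶠ N in atTop, |lam 0| < R N ∧ R₀ ≤ R N ∧ 0 < R N := by
    filter_upwards [hRtop.eventually_gt_atTop |lam 0|, hRtop.eventually_ge_atTop R₀,
      hRtop.eventually_gt_atTop 0] with N h1 h2 h3 using ⟨h1, h2, h3⟩
  have habs : ∀ N, |lam 0| < R N → ∀ n ≤ N, |lam n| < R N := by
    intro N hN n hn
    have h1 := hmono.monotone (Nat.zero_le n)
    have h2 := hmono.monotone hn
    have h3 := hlamR N
    rw [abs_lt] at hN ⊢
    constructor <;> linarith
  have hneR : ∀ N, |lam 0| < R N → ∀ n, |lam n| ≠ R N := by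
    intro N hN n
    rcases le_or_gt n N with h | h
    · exact (habs N hN n h).ne
    · have h1 := hmono.monotone (Nat.succ_le_of_lt h)
      have h2 := hRlam N
      have h3 := le_abs_self (lam n)
      exact ne_of_gt (by simp only [Nat.succ_eq_add_one] at h1; linarith)
  have hzne : ∀ N, |lam 0| < R N → ∀ z : ℂ, ‖z‖ = R N → ∀ n, z ≠ lam n := by
    rintro N hN z hz n rfl
    rw [Complex.norm_real, Real.norm_eq_abs] at hz
    exact hneR N hN n hz
  set F : ℕ → ℝ → ℂ := fun N θ => -(circleMap 0 (R N) θ) * f (circleMap 0 (R N) θ) *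
    (1 - Complex.exp (θ * Complex.I) ^ 2) with hF
  have hmain : ∀ᶠ N in atTop, ∫ θ in (0 : ℝ)..2 * Real.pi, F N θ =
      2 * Real.pi * ((∑ n ∈ Finset.range (N + 1), a n * (1 - lam n ^ 2 / R N ^ 2) : ℝ) : ℂ) := by
    filter_upwards [hbig] with N hN
    have hR0 : (R N : ℂ) ≠ 0 := Complex.ofReal_ne_zero.2 hN.2.2.ne'
    have hinj : Function.Injective (fun n => (lam n : ℂ)) :=
      Complex.ofReal_injective.comp hmono.injective
    have key := circleIntegral_eq_sum_of_simple_poles (h := fun z => f z * (1 - z ^ 2 / R N ^ 2))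
      (S := (Finset.range (N + 1)).map ⟨fun n => (lam n : ℂ), hinj⟩) (R := R N)
      (ρ := fun s => limUnder (𝓝[≠] s) fun z => (z - s) * (f z * (1 - z ^ 2 / R N ^ 2)))
      hN.2.2 ?_ ?_ ?_
    · have hlim : ∀ n, limUnder (𝓝[≠] (lam n : ℂ))
          (fun z => (z - lam n) * (f z * (1 - z ^ 2 / R N ^ 2))) =
          -(a n * (1 - lam n ^ 2 / R N ^ 2) : ℂ) := by
        intro n
        refine Tendsto.limUnder_eq ?_
        have : ContinuousAt (fun z : ℂ => 1 - z ^ 2 / (R N : ℂ) ^ 2) (lam n) := by fun_prop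
        have h := (hres n).mul (this.tendsto.mono_left nhdsWithin_le_nhds)
        rw [neg_mul] at h
        exact h.congr fun z => by ring
      rw [Finset.sum_map] at key
      simp only [Function.Embedding.coeFn_mk, hlim] at key
      have hI : (∮ z in C(0, R N), f z * (1 - z ^ 2 / R N ^ 2)) =
          -Complex.I * ∫ θ in (0 : ℝ)..2 * Real.pi, F N θ := by
        rw [circleIntegral, ← intervalIntegral.integral_const_mul]
        refine intervalIntegral.integral_congr fun θ _ => ?_
        simp only [hF, deriv_circleMap, smul_eq_mul]
        have : circleMap 0 (R N) θ ^ 2 / (R N : ℂ) ^ 2 = Complex.exp (θ * Complex.I) ^ 2 := by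
          rw [circleMap_zero]
          field_simp
        rw [this]
        ring
      rw [hI] at key
      have hI0 := Complex.I_ne_zero
      apply mul_left_cancel₀ (neg_ne_zero.2 hI0)
      rw [key, Finset.sum_neg_distrib]
      push_cast
      ring
    · intro s hs
      obtain ⟨n, hn, rfl⟩ := Finset.mem_map.1 hs
      simp only [Function.Embedding.coeFn_mk, mem_ball_zero_iff, Complex.norm_real,
        Real.norm_eq_abs]
      exact habs N hN.1 n (by simpa [Nat.lt_succ_iff] using hn)
    · intro z hz hzS
      refine DifferentiableAt.mul (hd z ?_) (by fun_prop)
      rintro n rfl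
      have h1 : |lam n| ≤ R N := by simpa using hz
      apply hzS
      refine Finset.mem_map.2 ⟨n, ?_, rfl⟩
      by_contra hn
      have h2 : N + 1 ≤ n := by simpa using hn
      have h3 := hmono.monotone h2
      have h4 := hRlam N
      have h5 := le_abs_self (lam n)
      linarith
    · intro s hs
      obtain ⟨n, hn, rfl⟩ := Finset.mem_map.1 hs
      simp only [Function.Embedding.coeFn_mk]
      have : ContinuousAt (fun z : ℂ => 1 - z ^ 2 / (R N : ℂ) ^ 2) (lam n) := by fun_prop
      have h := (hres n).mul (this.tendsto.mono_left nhdsWithin_le_nhds)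
      refine tendsto_nhds_limUnder ⟨_, h.congr fun z => ?_⟩
      ring
  have hsin : ∀ᵐ θ : ℝ, Real.sin θ ≠ 0 := by
    have : ({θ : ℝ | Real.sin θ = 0}).Countable := by
      have h : {θ : ℝ | Real.sin θ = 0} = Set.range fun n : ℤ => (n : ℝ) * Real.pi := by
        ext θ
        simp [Real.sin_eq_zero_iff]
      rw [h]
      exact Set.countable_range _
    simpa [ae_iff] using this.measure_zero volume
  have hint : Tendsto (fun N => ∫ θ in (0 : ℝ)..2 * Real.pi, F N θ) atTop
      (𝓝 (∫ θ in (0 : ℝ)..2 * Real.pi, (L : ℂ) * (1 - Complex.exp (θ * Complex.I) ^ 2))) := by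
    refine intervalIntegral.tendsto_integral_filter_of_dominated_convergence
      (fun _ => C * 2) ?_ ?_ (by simp) ?_
    · filter_upwards [hbig] with N hN
      refine Continuous.aestronglyMeasurable ?_
      have hfc : Continuous fun θ => f (circleMap 0 (R N) θ) := by
        refine continuous_iff_continuousAt.2 fun θ => ?_
        refine ContinuousAt.comp (f := circleMap 0 (R N)) (hd _ ?_).continuousAt
          (continuous_circleMap 0 (R N)).continuousAt
        exact hzne N hN.1 _ (by simp [abs_of_pos hN.2.2])
      exact ((continuous_circleMap 0 (R N)).neg.mul hfc).mul (by fun_prop)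
    · filter_upwards [hbig] with N hN
      filter_upwards [hsin] with θ hθ _
      have him : (circleMap 0 (R N) θ).im = R N * Real.sin θ := by
        simp [circleMap_zero, Complex.exp_ofReal_mul_I_re, Complex.exp_ofReal_mul_I_im]
      have hn : ‖circleMap 0 (R N) θ‖ = R N := by simp [abs_of_pos hN.2.2]
      have h1 := hbd (circleMap 0 (R N) θ) (by rw [hn]; exact hN.2.1)
        (by rw [him]; exact mul_ne_zero hN.2.2.ne' hθ)
      rw [him, abs_mul, abs_of_pos hN.2.2] at h1
      simp only [hF]
      rw [norm_mul, norm_mul, norm_neg, hn, norm_one_sub_exp_sq]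
      have hs : 0 < |Real.sin θ| := abs_pos.2 hθ
      have hR0 := hN.2.2
      calc R N * ‖f (circleMap 0 (R N) θ)‖ * (2 * |Real.sin θ|)
          ≤ R N * (C / (R N * |Real.sin θ|)) * (2 * |Real.sin θ|) := by gcongr
        _ = C * 2 := by field_simp
    · filter_upwards [hsin] with θ hθ _
      exact ((hray θ hθ).comp hRtop).mul_const _
  rw [intervalIntegral.integral_const_mul, integral_one_sub_exp_two_mul] at hint
  have hpi : (2 * Real.pi : ℂ) ≠ 0 := by simp [Real.pi_ne_zero]
  have hsumC : Tendsto (fun N => ((∑ n ∈ Finset.range (N + 1),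
      a n * (1 - lam n ^ 2 / R N ^ 2) : ℝ) : ℂ)) atTop (𝓝 (L : ℂ)) := by
    have := (hint.congr' hmain).div_const (2 * Real.pi : ℂ)
    simpa only [mul_div_cancel_right₀ _ hpi, mul_div_cancel_left₀ _ hpi] using this
  have hsumR : Tendsto (fun N => ∑ n ∈ Finset.range (N + 1),
      a n * (1 - lam n ^ 2 / R N ^ 2)) atTop (𝓝 L) := by
    simpa only [Function.comp_def, Complex.ofReal_re] using
      (Complex.continuous_re.tendsto _).comp hsumC
  refine tendsto_sum_range_of_weighted (w := fun N n => 1 - lam n ^ 2 / R N ^ 2) hpos ?_ ?_ ?_ hsumR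
  · filter_upwards [hbig] with N hN n hn
    have h1 : lam n ^ 2 ≤ R N ^ 2 := sq_le_sq.2 (by
      rw [abs_of_pos hN.2.2]; exact (habs N hN.1 n hn).le)
    have : 0 < R N ^ 2 := pow_pos hN.2.2 2
    rw [sub_nonneg, div_le_one this]
    exact h1
  · filter_upwards with N n _
    have : 0 ≤ lam n ^ 2 / R N ^ 2 := by positivity
    linarith
  · intro n
    have h : Tendsto (fun N => lam n ^ 2 / R N ^ 2) atTop (𝓝 0) :=
      tendsto_const_nhds.div_atTop ((tendsto_pow_atTop two_ne_zero).comp hRtop)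
    simpa using h.const_sub 1

section LinearODE

variable {Λ E : Type*} [NormedAddCommGroup E] [NormedSpace ℝ E]

/-- The Picard iterates of the linear initial value problem `y' = A y`, `y c = x₀`, written as
the terms of a series. -/
def picardTerm (A : Λ → ℝ → E →L[ℝ] E) (x₀ : Λ → E) (c : ℝ) : ℕ → Λ × ℝ → E
  | 0 => fun x => x₀ x.1
  | n + 1 => fun x => ∫ s in c..x.2, A x.1 s (picardTerm A x₀ c n (x.1, s))

variable {A : Λ → ℝ → E →L[ℝ] E} {x₀ : Λ → E} {c : ℝ} {K : Λ → ℝ}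

theorem continuous_picardTerm [TopologicalSpace Λ] (hA : Continuous fun x : Λ × ℝ => A x.1 x.2) (hx₀ : Continuous x₀)
    (n : ℕ) : Continuous (picardTerm A x₀ c n) := by
  induction n with
  | zero => exact hx₀.comp continuous_fst
  | succ n ih =>
    refine intervalIntegral.continuous_parametric_intervalIntegral_of_continuous
      (X := Λ × ℝ) (f := fun x s => A x.1 s (picardTerm A x₀ c n (x.1, s))) ?_ continuous_snd
    have h : Continuous fun y : (Λ × ℝ) × ℝ => ((y.1.1, y.2) : Λ × ℝ) := by fun_prop
    exact (hA.comp h).clm_apply (ih.comp h)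

theorem norm_picardTerm_le (hK : ∀ l s, ‖A l s‖ ≤ K l) (n : ℕ) (l : Λ) (z : ℝ) :
    ‖picardTerm A x₀ c n (l, z)‖ ≤ ‖x₀ l‖ * ((K l * |z - c|) ^ n / n.factorial) := by
  induction n generalizing z with
  | zero => simp [picardTerm]
  | succ n ih =>
    have hK0 : 0 ≤ K l := (norm_nonneg _).trans (hK l 0)
    have hint : Continuous fun s : ℝ =>
        K l * (‖x₀ l‖ * ((K l * |s - c|) ^ n / n.factorial)) := by fun_prop
    refine (intervalIntegral.norm_integral_le_abs_of_norm_le (Eventually.of_forall fun s => ?_)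
      (hint.intervalIntegrable c z)).trans ?_
    · exact ((A l s).le_opNorm _).trans
        (mul_le_mul (hK l s) (ih s) (norm_nonneg _) hK0)
    · rw [intervalIntegral.abs_intervalIntegral_eq, abs_of_nonneg]
      · have : ∀ s : ℝ, K l * (‖x₀ l‖ * ((K l * |s - c|) ^ n / n.factorial)) =
            (‖x₀ l‖ * K l ^ (n + 1) / n.factorial) * |s - c| ^ n := by
          intro s
          rw [mul_pow]
          ring
        simp only [this]
        rw [MeasureTheory.integral_const_mul, integral_pow_abs_sub_uIoc, mul_pow,
          Nat.factorial_succ]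
        push_cast
        refine le_of_eq ?_
        have h1 : (n.factorial : ℝ) ≠ 0 := by positivity
        have h2 : (n : ℝ) + 1 ≠ 0 := by positivity
        field_simp
      · exact integral_nonneg fun s => by positivity

/-- Global solutions of bounded linear ODEs, depending continuously on a parameter. -/
theorem exists_continuous_linear_ode_solution [TopologicalSpace Λ] [CompleteSpace E]
    (hA : Continuous fun x : Λ × ℝ => A x.1 x.2) (hx₀ : Continuous x₀)
    (hK : ∀ l s, ‖A l s‖ ≤ K l) (hKc : Continuous K) (c : ℝ) :
    ∃ y : Λ → ℝ → E, (Continuous fun x : Λ × ℝ => y x.1 x.2) ∧ (∀ l, y l c = x₀ l) ∧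
      ∀ l z, HasDerivAt (y l) (A l z (y l z)) z := by
  have hsum : ∀ l z, Summable fun n => picardTerm A x₀ c n (l, z) := fun l z =>
    Summable.of_norm_bounded ((Real.summable_pow_div_factorial _).mul_left _)
      fun n => norm_picardTerm_le hK n l z
  have hcont : Continuous fun x : Λ × ℝ => ∑' n, picardTerm A x₀ c n x := by
    refine continuous_iff_continuousAt.2 fun x => ?_
    set M := ‖x₀ x.1‖ + 1
    set T := K x.1 * |x.2 - c| + 1
    have h1 : ∀ᶠ y : Λ × ℝ in 𝓝 x, ‖x₀ y.1‖ < M ∧ K y.1 * |y.2 - c| < T := by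
      have hc1 : Continuous fun y : Λ × ℝ => ‖x₀ y.1‖ := by fun_prop
      have hc2 : Continuous fun y : Λ × ℝ => K y.1 * |y.2 - c| := by fun_prop
      exact ((hc1.tendsto x).eventually_lt_const (lt_add_one _)).and
        ((hc2.tendsto x).eventually_lt_const (lt_add_one _))
    have h2 : ContinuousOn (fun x : Λ × ℝ => ∑' n, picardTerm A x₀ c n x)
        {y | ‖x₀ y.1‖ < M ∧ K y.1 * |y.2 - c| < T} := by
      have hS : Summable fun n : ℕ => M * (T ^ n / n.factorial) :=
        (Real.summable_pow_div_factorial T).mul_left M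
      refine continuousOn_tsum (fun n => (continuous_picardTerm hA hx₀ n).continuousOn) hS ?_
      rintro n y ⟨h2, h3⟩
      have hK0 : 0 ≤ K y.1 := (norm_nonneg _).trans (hK y.1 0)
      refine (norm_picardTerm_le hK n y.1 y.2).trans ?_
      gcongr
    exact h2.continuousAt h1
  have hcl : ∀ l, Continuous fun z => ∑' n, picardTerm A x₀ c n (l, z) := fun l =>
    hcont.comp (f := fun z : ℝ => ((l, z) : Λ × ℝ)) (by fun_prop)
  have hAl : ∀ l, Continuous (A l) := fun l =>
    hA.comp (f := fun z : ℝ => ((l, z) : Λ × ℝ)) (by fun_prop)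
  have hfix : ∀ l z, ∑' n, picardTerm A x₀ c n (l, z) =
      x₀ l + ∫ s in c..z, A l s (∑' n, picardTerm A x₀ c n (l, s)) := by
    intro l z
    rw [(hsum l z).tsum_eq_zero_add]
    congr 1
    have hK0 : 0 ≤ K l := (norm_nonneg _).trans (hK l 0)
    have hs : HasSum (fun n => ∫ s in c..z, A l s (picardTerm A x₀ c n (l, s)))
        (∫ s in c..z, A l s (∑' n, picardTerm A x₀ c n (l, s))) := by
      refine intervalIntegral.hasSum_integral_of_dominated_convergence
        (fun n s => K l * (‖x₀ l‖ * ((K l * |z - c|) ^ n / n.factorial))) (fun n => ?_)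
        (fun n => ?_) ?_ ?_ ?_
      · refine Continuous.aestronglyMeasurable ?_
        exact (hAl l).clm_apply ((continuous_picardTerm hA hx₀ n).comp (by fun_prop))
      · refine Eventually.of_forall fun s hs => ((A l s).le_opNorm _).trans
          (mul_le_mul (hK l s) ((norm_picardTerm_le hK n l s).trans ?_)
            (norm_nonneg _) hK0)
        have : |s - c| ≤ |z - c| := by
          rcases Set.mem_uIoc.1 hs with h | h
          · rw [abs_of_nonneg, abs_of_nonneg] <;> linarith [h.1, h.2]
          · rw [abs_of_nonpos, abs_of_nonpos] <;> linarith [h.1, h.2]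
        gcongr
      · exact Eventually.of_forall fun s _ =>
          ((Real.summable_pow_div_factorial _).mul_left _).mul_left _
      · simp
      · exact Eventually.of_forall fun s _ => (A l s).hasSum (hsum l s).hasSum
    exact hs.tsum_eq
  refine ⟨fun l z => ∑' n, picardTerm A x₀ c n (l, z), hcont, fun l => by simp [hfix l c],
    fun l z => ?_⟩
  have hc : Continuous fun s => A l s (∑' n, picardTerm A x₀ c n (l, s)) :=
    (hAl l).clm_apply (hcl l)
  have h := (hc.integral_hasStrictDerivAt c z).hasDerivAt.const_add (x₀ l)
  exact h.congr_of_eventuallyEq (Eventually.of_forall fun w => hfix l w)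

end LinearODE

namespace SLP

variable (P : SLP)

/-- `(u, v)` solves the first-order system `p u' = v`, `v' = (q - l r) u` on `[z1, z2]`. -/
def IsSol (l : ℂ) (u v : ℝ → ℂ) : Prop :=
  ∀ z ∈ Set.Icc P.z1 P.z2, HasDerivAt u (v z / P.p z) z ∧
    HasDerivAt v ((P.q z - l * P.r z) * u z) z

/-- The functional `B_j` on pairs `(φ, p φ')`. -/
def bdB (j : Fin 2) (u v : ℝ → ℂ) : ℂ := P.a j * u (P.zb j) - P.b j * v (P.zb j)

/-- The functional `C_j` on pairs `(φ, p φ')`. -/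
def bdC (j : Fin 2) (u v : ℝ → ℂ) : ℂ := P.c j * u (P.zb j) - P.d j * v (P.zb j)

/-- The Wronskian of two pairs. -/
def wron (u v w s : ℝ → ℂ) (z : ℝ) : ℂ := u z * s z - v z * w z

variable {P}

theorem zb_mem (j : Fin 2) : P.zb j ∈ Set.Icc P.z1 P.z2 := by
  fin_cases j <;> simp [zb, P.hz.le]

theorem p_ne_zero {z : ℝ} (hz : z ∈ Set.Icc P.z1 P.z2) : (P.p z : ℂ) ≠ 0 :=
  Complex.ofReal_ne_zero.2 (P.hppos z hz).ne'

theorem continuous_p : Continuous P.p := P.hp.continuous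

theorem continuous_r : Continuous P.r := P.hr.continuous

theorem continuous_q : Continuous P.q := P.hq

theorem uIcc_subset {x y : ℝ} (hx : x ∈ Set.Icc P.z1 P.z2) (hy : y ∈ Set.Icc P.z1 P.z2) :
    Set.uIcc x y ⊆ Set.Icc P.z1 P.z2 :=
  Set.ordConnected_Icc.uIcc_subset hx hy

theorem IsSol.continuousOn {l : ℂ} {u v : ℝ → ℂ} (h : P.IsSol l u v) :
    ContinuousOn u (Set.Icc P.z1 P.z2) ∧ ContinuousOn v (Set.Icc P.z1 P.z2) :=
  ⟨fun z hz => (h z hz).1.continuousAt.continuousWithinAt,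
    fun z hz => (h z hz).2.continuousAt.continuousWithinAt⟩

theorem continuousOn_of_hasDerivAt {f f' : ℝ → ℂ} {s : Set ℝ}
    (h : ∀ z ∈ s, HasDerivAt f (f' z) z) : ContinuousOn f s :=
  fun z hz => (h z hz).continuousAt.continuousWithinAt

theorem integral_wron {l : ℂ} {u v w s g : ℝ → ℂ} (h : P.IsSol l u v)
    (hw : ∀ z ∈ Set.Icc P.z1 P.z2, HasDerivAt w (s z / P.p z) z)
    (hs : ∀ z ∈ Set.Icc P.z1 P.z2, HasDerivAt s (g z) z)
    (hg : ContinuousOn g (Set.Icc P.z1 P.z2)) {x y : ℝ} (hx : x ∈ Set.Icc P.z1 P.z2)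
    (hy : y ∈ Set.Icc P.z1 P.z2) :
    ∫ z in x..y, (u z * g z - (P.q z - l * P.r z) * u z * w z) =
      wron u v w s y - wron u v w s x := by
  have hsub := uIcc_subset hx hy
  have hq := continuous_q (P := P)
  have hr := continuous_r (P := P)
  refine intervalIntegral.integral_eq_sub_of_hasDerivAt (f := wron u v w s) (fun z hz => ?_)
    (ContinuousOn.intervalIntegrable (ContinuousOn.mono ?_ hsub))
  · have hz' := hsub hz
    have h1 := ((h z hz').1.mul (hs z hz')).sub ((h z hz').2.mul (hw z hz'))
    refine h1.congr_deriv ?_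
    ring
  · have h1 := h.continuousOn.1
    have h2 := continuousOn_of_hasDerivAt hw
    have h3 : ContinuousOn (fun z => (P.q z - l * P.r z : ℂ)) (Set.Icc P.z1 P.z2) :=
      Continuous.continuousOn (by fun_prop)
    exact (h1.mul hg).sub ((h3.mul h1).mul h2)

theorem IsSol.hasDerivAt_continuousOn {l : ℂ} {u v : ℝ → ℂ} (h : P.IsSol l u v) :
    ContinuousOn (fun z => (P.q z - l * P.r z) * u z) (Set.Icc P.z1 P.z2) := by
  have hq := continuous_q (P := P)
  have hr := continuous_r (P := P)
  have h3 : ContinuousOn (fun z => (P.q z - l * P.r z : ℂ)) (Set.Icc P.z1 P.z2) :=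
    Continuous.continuousOn (by fun_prop)
  exact h3.mul h.continuousOn.1

/-- Lagrange's identity for two solutions. -/
theorem IsSol.lagrange {l m : ℂ} {u v w s : ℝ → ℂ} (h : P.IsSol l u v) (h' : P.IsSol m w s)
    {x y : ℝ} (hx : x ∈ Set.Icc P.z1 P.z2) (hy : y ∈ Set.Icc P.z1 P.z2) :
    (l - m) * ∫ z in x..y, u z * w z * P.r z = wron u v w s y - wron u v w s x := by
  rw [← integral_wron h (fun z hz => (h' z hz).1) (fun z hz => (h' z hz).2)
    h'.hasDerivAt_continuousOn hx hy, ← intervalIntegral.integral_const_mul]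
  congr 1
  ext z
  ring

/-- The coefficient of the first-order system, with coefficients frozen outside `[z1, z2]`. -/
def odeCoeff (P : SLP) (l : ℂ) (z : ℝ) : ℂ × ℂ →L[ℝ] ℂ × ℂ :=
  ((P.p (Set.projIcc P.z1 P.z2 P.hz.le z) : ℂ)⁻¹) •
      ((ContinuousLinearMap.snd ℝ ℂ ℂ).prod 0) +
    ((P.q (Set.projIcc P.z1 P.z2 P.hz.le z) : ℂ) -
      l * (P.r (Set.projIcc P.z1 P.z2 P.hz.le z) : ℂ)) •
      ((0 : ℂ × ℂ →L[ℝ] ℂ).prod (ContinuousLinearMap.fst ℝ ℂ ℂ))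

theorem exists_sol (P : SLP) (c : ℝ) {α β : ℂ → ℂ} (hα : Continuous α)
    (hβ : Continuous β) : ∃ u v : ℂ → ℝ → ℂ, (Continuous fun x : ℂ × ℝ => u x.1 x.2) ∧
      (Continuous fun x : ℂ × ℝ => v x.1 x.2) ∧
      ∀ l, u l c = α l ∧ v l c = β l ∧ P.IsSol l (u l) (v l) := by
  have hcp : Continuous fun z => P.p (Set.projIcc P.z1 P.z2 P.hz.le z) :=
    continuous_p.comp (continuous_subtype_val.comp continuous_projIcc)
  have hcq : Continuous fun z => P.q (Set.projIcc P.z1 P.z2 P.hz.le z) :=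
    continuous_q.comp (continuous_subtype_val.comp continuous_projIcc)
  have hcr : Continuous fun z => P.r (Set.projIcc P.z1 P.z2 P.hz.le z) :=
    continuous_r.comp (continuous_subtype_val.comp continuous_projIcc)
  have hp0 : ∀ z, (P.p (Set.projIcc P.z1 P.z2 P.hz.le z) : ℂ) ≠ 0 := fun z =>
    p_ne_zero (Subtype.coe_prop _)
  have hA : Continuous fun x : ℂ × ℝ => P.odeCoeff x.1 x.2 := by
    have h1 : Continuous fun x : ℂ × ℝ => (P.p (Set.projIcc P.z1 P.z2 P.hz.le x.2) : ℂ)⁻¹ :=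
      (Complex.continuous_ofReal.comp (hcp.comp continuous_snd)).inv₀ fun x => hp0 x.2
    have h2 : Continuous fun x : ℂ × ℝ => (P.q (Set.projIcc P.z1 P.z2 P.hz.le x.2) : ℂ) -
        x.1 * (P.r (Set.projIcc P.z1 P.z2 P.hz.le x.2) : ℂ) :=
      (Complex.continuous_ofReal.comp (hcq.comp continuous_snd)).sub
        (continuous_fst.mul (Complex.continuous_ofReal.comp (hcr.comp continuous_snd)))
    exact (h1.smul continuous_const).add (h2.smul continuous_const)
  obtain ⟨M, hM⟩ := isCompact_Icc.exists_bound_of_continuousOn (s := Set.Icc P.z1 P.z2)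
    (f := fun z => P.odeCoeff 0 z)
    (hA.comp (f := fun z : ℝ => ((0, z) : ℂ × ℝ)) (by fun_prop)).continuousOn
  obtain ⟨M', hM'⟩ := isCompact_Icc.exists_bound_of_continuousOn (s := Set.Icc P.z1 P.z2)
    (f := fun z => P.odeCoeff 1 z - P.odeCoeff 0 z)
    ((hA.comp (f := fun z : ℝ => ((1, z) : ℂ × ℝ)) (by fun_prop)).sub
    (hA.comp (f := fun z : ℝ => ((0, z) : ℂ × ℝ)) (by fun_prop))).continuousOn
  have hK : ∀ l z, ‖P.odeCoeff l z‖ ≤ M + ‖l‖ * M' := by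
    intro l z
    have h1 : P.odeCoeff l z = P.odeCoeff 0 (Set.projIcc P.z1 P.z2 P.hz.le z) +
        l • (P.odeCoeff 1 (Set.projIcc P.z1 P.z2 P.hz.le z) -
          P.odeCoeff 0 (Set.projIcc P.z1 P.z2 P.hz.le z)) := by
      simp only [odeCoeff, Set.projIcc_val]
      module
    rw [h1]
    refine (norm_add_le _ _).trans (add_le_add (hM _ (Subtype.coe_prop _)) ?_)
    rw [norm_smul]
    exact mul_le_mul_of_nonneg_left (hM' _ (Subtype.coe_prop _)) (norm_nonneg _)
  obtain ⟨y, hyc, hy0, hy⟩ := exists_continuous_linear_ode_solution (A := P.odeCoeff)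
    (x₀ := fun l => (α l, β l)) hA (by fun_prop) hK (by fun_prop) c
  refine ⟨fun l z => (y l z).1, fun l z => (y l z).2, by fun_prop, by fun_prop,
    fun l => ⟨by simp [hy0], by simp [hy0], fun z hz => ?_⟩⟩
  have h := hy l z
  have hproj : (Set.projIcc P.z1 P.z2 P.hz.le z : ℝ) = z := by
    rw [Set.projIcc_of_mem _ hz]
  have e : P.odeCoeff l z (y l z) =
      ((y l z).2 / P.p z, (P.q z - l * P.r z) * (y l z).1) := by
    simp [odeCoeff, hproj, div_eq_inv_mul]
  rw [e] at h
  exact ⟨h.fst, h.snd⟩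

theorem IsSol.eq_zero {l : ℂ} {u v : ℝ → ℂ} (h : P.IsSol l u v) {c : ℝ}
    (hc : c ∈ Set.Icc P.z1 P.z2) (hu : u c = 0) (hv : v c = 0) {z : ℝ}
    (hz : z ∈ Set.Icc P.z1 P.z2) : u z = 0 ∧ v z = 0 := by
  have key : ∀ α β : ℂ, u z * β - v z * α = 0 := by
    intro α β
    obtain ⟨w, s, -, -, hws⟩ := exists_sol P z (continuous_const (y := α))
      (continuous_const (y := β))
    have := h.lagrange (hws l).2.2 hc hz
    rw [sub_self, zero_mul] at this
    simpa [wron, hu, hv, (hws l).1, (hws l).2.1] using this.symm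
  exact ⟨by simpa using key 0 1, by simpa using key 1 0⟩

theorem IsSol.sub_smul {l : ℂ} {u v w s : ℝ → ℂ} (h : P.IsSol l u v) (h' : P.IsSol l w s)
    (k : ℂ) : P.IsSol l (fun z => u z - k * w z) (fun z => v z - k * s z) := fun z hz =>
  ⟨((h z hz).1.sub ((h' z hz).1.const_mul k)).congr_deriv (by ring),
    ((h z hz).2.sub ((h' z hz).2.const_mul k)).congr_deriv (by ring)⟩

theorem IsSol.smul {l : ℂ} {w s : ℝ → ℂ} (h' : P.IsSol l w s)
    (k : ℂ) : P.IsSol l (fun z => k * w z) (fun z => k * s z) := fun z hz =>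
  ⟨((h' z hz).1.const_mul k).congr_deriv (by ring),
    ((h' z hz).2.const_mul k).congr_deriv (by ring)⟩

theorem IsSol.conj {l : ℂ} {u v : ℝ → ℂ} (h : P.IsSol l u v) :
    P.IsSol (starRingEnd ℂ l) (fun z => starRingEnd ℂ (u z)) (fun z => starRingEnd ℂ (v z)) :=
  fun z hz => ⟨((h z hz).1.star).congr_deriv (by simp),
    ((h z hz).2.star).congr_deriv (by simp)⟩

theorem eqOn_Icc_of_eqOn_Ioo {f g : ℝ → ℂ} (hf : ContinuousOn f (Set.Icc P.z1 P.z2))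
    (hg : ContinuousOn g (Set.Icc P.z1 P.z2)) (h : ∀ z ∈ Set.Ioo P.z1 P.z2, f z = g z) {z : ℝ}
    (hz : z ∈ Set.Icc P.z1 P.z2) : f z = g z := by
  have hc : Set.Icc P.z1 P.z2 ⊆ closure (Set.Ioo P.z1 P.z2) := by
    rw [closure_Ioo P.hz.ne]
  have : Set.EqOn f g (Set.Ioo P.z1 P.z2) := h
  exact this.of_subset_closure hf hg Set.Ioo_subset_Icc_self hc hz

theorem IsEigenpair.isSol {l : ℂ} {φ : ℝ → ℂ} (h : P.IsEigenpair l φ) :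
    P.IsSol l φ (fun w => (P.p w : ℂ) * deriv φ w) := by
  obtain ⟨hφ, -, hode, -⟩ := h
  have hφ1 : ContDiff ℝ 1 (deriv φ) := ((contDiff_succ_iff_deriv (n := 1)).1 hφ).2.2
  have hp : ContDiff ℝ 1 fun z => (P.p z : ℂ) :=
    Complex.ofRealCLM.contDiff.comp (P.hp.of_le (by norm_num))
  have hv : ContDiff ℝ 1 fun w => (P.p w : ℂ) * deriv φ w := hp.mul hφ1
  have hvd : Continuous (deriv fun w => (P.p w : ℂ) * deriv φ w) := hv.continuous_deriv le_rfl
  have hq := continuous_q (P := P)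
  have hr := continuous_r (P := P)
  have hφc := hφ.continuous
  intro z hz
  refine ⟨?_, ?_⟩
  · have h1 := (hφ.differentiable (by norm_num) z).hasDerivAt
    rwa [mul_div_cancel_left₀ _ (p_ne_zero hz)]
  · have h1 := (hv.differentiable (by norm_num) z).hasDerivAt
    refine h1.congr_deriv ?_
    refine eqOn_Icc_of_eqOn_Ioo hvd.continuousOn
      (g := fun z => ((P.q z : ℂ) - l * P.r z) * φ z)
      (Continuous.continuousOn (by fun_prop)) (fun w hw => ?_) hz
    linear_combination (-1 : ℂ) * hode w hw

/-- A nontrivial solution extends to a twice continuously differentiable function on the line. -/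
theorem IsSol.exists_contDiff {l : ℂ} {u v : ℝ → ℂ} (h : P.IsSol l u v) :
    ∃ φ : ℝ → ℂ, ContDiff ℝ 2 φ ∧ (∀ z ∈ Set.Icc P.z1 P.z2, φ z = u z) ∧
      ∀ z ∈ Set.Icc P.z1 P.z2, (P.p z : ℂ) * deriv φ z = v z := by
  set g₀ : ℝ → ℂ := fun z => (((P.q z - l * P.r z) * u z) * P.p z - v z * deriv P.p z) /
    (P.p z : ℂ) ^ 2 with hg₀
  have hpd : Continuous (deriv P.p) := P.hp.continuous_deriv (by norm_num)
  have hpc := continuous_p (P := P)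
  have hg₀c : ContinuousOn g₀ (Set.Icc P.z1 P.z2) := by
    refine ContinuousOn.div ((h.hasDerivAt_continuousOn.mul
      (Continuous.continuousOn (by fun_prop))).sub (h.continuousOn.2.mul
      (Continuous.continuousOn (by fun_prop)))) (Continuous.continuousOn (by fun_prop))
      fun z hz => pow_ne_zero 2 (p_ne_zero hz)
  set g : ℝ → ℂ := Set.IccExtend P.hz.le ((Set.Icc P.z1 P.z2).domRestrict g₀) with hg
  have hgc : Continuous g := hg₀c.domRestrict.Icc_extend' (h := P.hz.le)
  have hgg : ∀ z ∈ Set.Icc P.z1 P.z2, g z = g₀ z := fun z hz => by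
    rw [hg, Set.IccExtend_of_mem _ _ hz, Set.domRestrict_apply]
  have hz1 : P.z1 ∈ Set.Icc P.z1 P.z2 := Set.left_mem_Icc.2 P.hz.le
  set w : ℝ → ℂ := fun z => v P.z1 / P.p P.z1 + ∫ s in P.z1..z, g s with hw
  have hwd : ∀ z, HasDerivAt w (g z) z := fun z =>
    (hgc.integral_hasStrictDerivAt P.z1 z).hasDerivAt.const_add _
  have hwc : Continuous w := continuous_iff_continuousAt.2 fun z => (hwd z).continuousAt
  have hwv : ∀ z ∈ Set.Icc P.z1 P.z2, w z = v z / P.p z := by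
    intro z hz
    have : ∫ s in P.z1..z, g s = v z / P.p z - v P.z1 / P.p P.z1 := by
      refine intervalIntegral.integral_eq_sub_of_hasDerivAt (f := fun z => v z / P.p z)
        (fun s hs => ?_) (hgc.intervalIntegrable _ _)
      have hs' := uIcc_subset hz1 hz hs
      have hpd' : HasDerivAt (fun z => (P.p z : ℂ)) ((deriv P.p s : ℝ) : ℂ) s :=
        (P.hp.differentiable (by norm_num) s).hasDerivAt.ofReal_comp
      refine ((h s hs').2.div hpd' (p_ne_zero hs')).congr_deriv ?_
      rw [hgg s hs']
    simp [hw, this]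
  set φ : ℝ → ℂ := fun z => u P.z1 + ∫ s in P.z1..z, w s with hφ
  have hφd : ∀ z, HasDerivAt φ (w z) z := fun z =>
    (hwc.integral_hasStrictDerivAt P.z1 z).hasDerivAt.const_add _
  have hdφ : deriv φ = w := funext fun z => (hφd z).deriv
  have hdw : deriv w = g := funext fun z => (hwd z).deriv
  refine ⟨φ, ?_, fun z hz => ?_, fun z hz => ?_⟩
  · refine (contDiff_succ_iff_deriv (n := 1)).2 ⟨fun z => (hφd z).differentiableAt, by simp, ?_⟩
    rw [hdφ]
    exact contDiff_one_iff_deriv.2 ⟨fun z => (hwd z).differentiableAt, by rwa [hdw]⟩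
  · have : ∫ s in P.z1..z, w s = u z - u P.z1 := by
      refine intervalIntegral.integral_eq_sub_of_hasDerivAt (fun s hs => ?_)
        (hwc.intervalIntegrable _ _)
      have hs' := uIcc_subset hz1 hz hs
      rw [hwv s hs']
      exact (h s hs').1
    simp [hφ, this]
  · rw [hdφ, hwv z hz, mul_div_cancel₀ _ (p_ne_zero hz)]

theorem IsSol.isEigenvalue {l : ℂ} {u v : ℝ → ℂ} (h : P.IsSol l u v) {c : ℝ}
    (hc : c ∈ Set.Icc P.z1 P.z2) (hne : ¬ (u c = 0 ∧ v c = 0))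
    (hbc : ∀ j, -P.bdB j u v = l * P.bdC j u v) : P.IsEigenvalue l := by
  obtain ⟨φ, hφ, hu, hv⟩ := h.exists_contDiff
  refine ⟨φ, hφ, ?_, fun z hz => ?_, fun j => ?_⟩
  · by_contra! h0
    have hu0 : ∀ z ∈ Set.Icc P.z1 P.z2, u z = 0 := fun z hz => (hu z hz).symm.trans (h0 z hz)
    refine hne ⟨hu0 c hc, ?_⟩
    have h1 : HasDerivWithinAt u (v c / P.p c) (Set.Icc P.z1 P.z2) c := (h c hc).1.hasDerivWithinAt
    have h2 : HasDerivWithinAt u 0 (Set.Icc P.z1 P.z2) c :=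
      (hasDerivWithinAt_const c _ (0 : ℂ)).congr hu0 (hu0 c hc)
    have := (uniqueDiffOn_Icc P.hz c hc).eq_deriv _ h1 h2
    exact (div_eq_zero_iff.1 this).resolve_right (p_ne_zero hc)
  · have hz' := Set.Ioo_subset_Icc_self hz
    have hev : (fun w => (P.p w : ℂ) * deriv φ w) =ᶠ[𝓝 z] v := by
      filter_upwards [isOpen_Ioo.mem_nhds hz] with w hw using hv w (Set.Ioo_subset_Icc_self hw)
    rw [hev.deriv_eq, (h z hz').2.deriv, hu z hz']
    ring
  · have h1 := hbc j
    rw [bdB, bdC, ← hu _ (zb_mem j), ← hv _ (zb_mem j)] at h1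
    exact h1

end SLP

theorem mul_mul_one_sub_pow_le_one (k : ℕ) {t : ℝ} (h0 : 0 ≤ t) (h1 : t ≤ 1) :
    k * t * (1 - t) ^ k ≤ 1 := by
  have h2 : 1 + (k : ℝ) * t ≤ (1 + t) ^ k := one_add_mul_le_pow (by linarith) k
  have h3 : (1 + t) ^ k * (1 - t) ^ k ≤ 1 := by
    rw [← mul_pow]
    exact pow_le_one₀ (mul_nonneg (by linarith) (by linarith)) (by nlinarith)
  have h4 : 0 ≤ (1 - t) ^ k := pow_nonneg (by linarith) k
  nlinarith [mul_le_mul_of_nonneg_right h2 h4]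

/-- Smooth functions with prescribed first-order data at `x`, vanishing to first order at `y`,
bounded and tending to zero in between. -/
theorem exists_contDiff_data (x y α β : ℝ) (hxy : x ≠ y) :
    ∃ (w : ℕ → ℝ → ℝ) (M : ℝ), (∀ k, ContDiff ℝ 2 (w k)) ∧
      (∀ k, w k x = α ∧ deriv (w k) x = β ∧ w k y = 0 ∧ deriv (w k) y = 0) ∧
      (∀ k, ∀ z ∈ Set.uIcc x y, |w k z| ≤ M) ∧
      ∀ z ∈ Set.uIcc x y, z ≠ x → Tendsto (fun k => w k z) atTop (𝓝 0) := by
  have hh : y - x ≠ 0 := sub_ne_zero.2 hxy.symm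
  set t : ℝ → ℝ := fun z => (z - x) / (y - x) with ht
  set w : ℕ → ℝ → ℝ := fun k z =>
    (α + ((y - x) * β + (k + 2) * α) * t z) * (1 - t z) ^ (k + 2) with hw
  have htx : t x = 0 := by simp [ht]
  have hty : t y = 1 := by simp [ht, hh]
  have htd : ∀ z, HasDerivAt t (y - x)⁻¹ z := fun z => by
    simpa [ht, div_eq_mul_inv] using ((hasDerivAt_id z).sub_const x).div_const (y - x)
  have hwd : ∀ k z, HasDerivAt (w k) ((((y - x) * β + (k + 2) * α) * (y - x)⁻¹) *
      (1 - t z) ^ (k + 2) + (α + ((y - x) * β + (k + 2) * α) * t z) *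
      (((k + 2 : ℕ) : ℝ) * (1 - t z) ^ (k + 1) * (-(y - x)⁻¹))) z := fun k z => by
    have h1 := ((htd z).const_mul ((y - x) * β + (k + 2) * α)).const_add α
    have h2 := ((htd z).const_sub 1).pow (k + 2)
    exact h1.mul h2
  have ht01 : ∀ z ∈ Set.uIcc x y, 0 ≤ t z ∧ t z ≤ 1 := by
    intro z hz
    rcases Set.mem_uIcc.1 hz with h | h
    · have h3 : 0 < y - x := lt_of_le_of_ne (by linarith [h.1, h.2]) hh.symm
      exact ⟨div_nonneg (by linarith [h.1]) h3.le, (div_le_one h3).2 (by linarith [h.2])⟩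
    · have h3 : y - x < 0 := lt_of_le_of_ne (by linarith [h.1, h.2]) hh
      exact ⟨div_nonneg_of_nonpos (by linarith [h.2]) h3.le,
        (div_le_one_of_neg h3).2 (by linarith [h.1])⟩
  refine ⟨w, |α| + (|(y - x) * β| + (|α| + 2 * |α|)), fun k => ?_, fun k => ⟨?_, ?_, ?_, ?_⟩, ?_, ?_⟩
  · simp only [hw, ht]
    fun_prop
  · simp [hw, htx]
  · rw [(hwd k x).deriv, htx]
    push_cast
    field_simp
    ring
  · simp [hw, hty]
  · rw [(hwd k y).deriv, hty]
    simp
  · intro k z hz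
    obtain ⟨h0, h1⟩ := ht01 z hz
    have h2 : 0 ≤ (1 - t z) ^ (k + 2) := pow_nonneg (by linarith) _
    have h3 : (1 - t z) ^ (k + 2) ≤ 1 := pow_le_one₀ (by linarith) (by linarith)
    have h4 := mul_mul_one_sub_pow_le_one (k + 2) h0 h1
    push_cast at h4
    have h5 : w k z = α * (1 - t z) ^ (k + 2) + ((y - x) * β * (t z * (1 - t z) ^ (k + 2)) +
        α * ((k + 2) * t z * (1 - t z) ^ (k + 2))) := by
      simp only [hw]
      ring
    have h6 : t z * (1 - t z) ^ (k + 2) ≤ 1 := mul_le_one₀ h1 h2 h3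
    have h7 : 0 ≤ ((k : ℝ) + 2) * t z * (1 - t z) ^ (k + 2) := by positivity
    have h8 : 0 ≤ t z * (1 - t z) ^ (k + 2) := by positivity
    rw [h5]
    refine (abs_add_le _ _).trans (add_le_add ?_ ((abs_add_le _ _).trans (add_le_add ?_ ?_)))
    · rw [abs_mul, abs_of_nonneg h2]
      exact mul_le_of_le_one_right (abs_nonneg _) h3
    · rw [abs_mul, abs_of_nonneg h8]
      exact mul_le_of_le_one_right (abs_nonneg _) h6
    · rw [abs_mul, abs_of_nonneg h7]
      nlinarith [abs_nonneg α]
  · intro z hz hzx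
    obtain ⟨h0, h1⟩ := ht01 z hz
    have h2 : 0 < t z := lt_of_le_of_ne h0 fun h =>
      hzx (by simpa [ht, hh, sub_eq_zero] using h.symm)
    have h3 : Tendsto (fun k : ℕ => (1 - t z) ^ (k + 2)) atTop (𝓝 0) :=
      (tendsto_pow_atTop_nhds_zero_of_lt_one (by linarith) (by linarith)).comp
        (tendsto_add_atTop_nat 2)
    have h4 : Tendsto (fun k : ℕ => ((k + 2 : ℕ) : ℝ) * (1 - t z) ^ (k + 2)) atTop (𝓝 0) :=
      (tendsto_self_mul_const_pow_of_lt_one (by linarith) (by linarith)).comp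
        (tendsto_add_atTop_nat 2)
    have h5 := (h3.const_mul (α + (y - x) * β * t z)).add (h4.const_mul (α * t z))
    rw [mul_zero, mul_zero, add_zero] at h5
    refine h5.congr fun k => ?_
    simp only [hw]
    push_cast
    ring

/-- Cauchy–Schwarz inequality for weighted integrals. -/
theorem sq_integral_mul_le {a b : ℝ} (hab : a ≤ b) {f g ρ : ℝ → ℝ}
    (hf : ContinuousOn f (Set.Icc a b)) (hg : ContinuousOn g (Set.Icc a b))
    (hρ : ContinuousOn ρ (Set.Icc a b)) (hρ0 : ∀ z ∈ Set.Icc a b, 0 ≤ ρ z) :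
    (∫ z in a..b, f z * g z * ρ z) ^ 2 ≤
      (∫ z in a..b, f z ^ 2 * ρ z) * ∫ z in a..b, g z ^ 2 * ρ z := by
  rw [← Set.uIcc_of_le hab] at hf hg hρ
  have h := discrim_le_zero (a := ∫ z in a..b, f z ^ 2 * ρ z)
    (b := 2 * ∫ z in a..b, f z * g z * ρ z) (c := ∫ z in a..b, g z ^ 2 * ρ z) fun t => ?_
  · rw [discrim] at h
    linarith
  · have h1 : 0 ≤ ∫ z in a..b, (t * f z + g z) ^ 2 * ρ z :=
      intervalIntegral.integral_nonneg hab fun z hz => mul_nonneg (sq_nonneg _) (hρ0 z hz)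
    have h2 : ∫ z in a..b, (t * f z + g z) ^ 2 * ρ z = ∫ z in a..b,
        ((t * t) * (f z ^ 2 * ρ z) + t * 2 * (f z * g z * ρ z) + g z ^ 2 * ρ z) := by
      congr 1
      ext z
      ring
    have i1 : IntervalIntegrable (fun z => (t * t) * (f z ^ 2 * ρ z)) volume a b :=
      (((hf.pow 2).mul hρ).const_smul (t * t)).intervalIntegrable
    have i2 : IntervalIntegrable (fun z => t * 2 * (f z * g z * ρ z)) volume a b :=
      (((hf.mul hg).mul hρ).const_smul (t * 2)).intervalIntegrable
    have i3 : IntervalIntegrable (fun z => g z ^ 2 * ρ z) volume a b :=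
      ((hg.pow 2).mul hρ).intervalIntegrable
    rw [h2, intervalIntegral.integral_add (i1.add i2) i3, intervalIntegral.integral_add i1 i2,
      intervalIntegral.integral_const_mul, intervalIntegral.integral_const_mul] at h1
    linarith

namespace SLP

variable {P : SLP}

/-- The weighted `L²` norm of a function on `[z1, z2]`. -/
def nrm (P : SLP) (u : ℝ → ℂ) : ℝ := √(∫ z in P.z1..P.z2, ‖u z‖ ^ 2 * P.r z)

theorem nrm_nonneg (u : ℝ → ℂ) : 0 ≤ P.nrm u := Real.sqrt_nonneg _

theorem nrm_sq (u : ℝ → ℂ) : P.nrm u ^ 2 = ∫ z in P.z1..P.z2, ‖u z‖ ^ 2 * P.r z :=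
  Real.sq_sqrt (intervalIntegral.integral_nonneg P.hz.le fun z hz =>
    mul_nonneg (sq_nonneg _) (P.hrpos z hz).le)

theorem norm_integral_mul_le {u g : ℝ → ℂ} (hu : ContinuousOn u (Set.Icc P.z1 P.z2))
    (hg : ContinuousOn g (Set.Icc P.z1 P.z2)) :
    ‖∫ z in P.z1..P.z2, u z * g z * P.r z‖ ≤ P.nrm u * P.nrm g := by
  have h1 := sq_integral_mul_le P.hz.le hu.norm hg.norm (continuous_r (P := P)).continuousOn
    fun z hz => (P.hrpos z hz).le
  rw [← nrm_sq, ← nrm_sq, ← mul_pow] at h1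
  refine (intervalIntegral.norm_integral_le_integral_norm P.hz.le).trans ?_
  have h2 : ∫ z in P.z1..P.z2, ‖u z * g z * P.r z‖ =
      ∫ z in P.z1..P.z2, ‖u z‖ * ‖g z‖ * P.r z := by
    refine intervalIntegral.integral_congr fun z hz => ?_
    rw [Set.uIcc_of_le P.hz.le] at hz
    simp only [norm_mul, Complex.norm_real, Real.norm_eq_abs, abs_of_pos (P.hrpos z hz)]
  rw [h2]
  exact abs_le_of_sq_le_sq' h1 (mul_nonneg (nrm_nonneg _) (nrm_nonneg _)) |>.2

theorem zb_ne {j o : Fin 2} (h : o ≠ j) : P.zb j ≠ P.zb o := by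
  have := P.hz.ne
  fin_cases j <;> fin_cases o <;> simp_all [zb, this.symm]

theorem uIcc_zb {j o : Fin 2} (h : o ≠ j) :
    Set.uIcc (P.zb j) (P.zb o) = Set.Icc P.z1 P.z2 := by
  fin_cases j <;> fin_cases o <;> simp_all [zb, P.hz.le]

theorem exists_small_data (P : SLP) (j : Fin 2) {ε : ℝ} (hε : 0 < ε) :
    ∃ w : ℝ → ℝ, ContDiff ℝ 2 w ∧ w (P.zb j) = P.b j ∧
      P.p (P.zb j) * deriv w (P.zb j) = P.a j ∧
      (∀ o ≠ j, w (P.zb o) = 0 ∧ deriv w (P.zb o) = 0) ∧ P.nrm (fun z => (w z : ℂ)) ≤ ε := by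
  obtain ⟨o, ho⟩ : ∃ o : Fin 2, o ≠ j := exists_ne j
  obtain ⟨w, M, hw, hdat, hM, hlim⟩ := exists_contDiff_data (P.zb j) (P.zb o) (P.b j)
    (P.a j / P.p (P.zb j)) (zb_ne ho)
  rw [uIcc_zb ho] at hM hlim
  have hr := continuous_r (P := P)
  obtain ⟨R, hR⟩ := isCompact_Icc.exists_bound_of_continuousOn (s := Set.Icc P.z1 P.z2)
    hr.continuousOn
  have hT : Tendsto (fun k => ∫ z in P.z1..P.z2, ‖(w k z : ℂ)‖ ^ 2 * P.r z) atTop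
      (𝓝 (∫ z in P.z1..P.z2, (0 : ℝ))) := by
    refine intervalIntegral.tendsto_integral_filter_of_dominated_convergence
      (fun _ => M ^ 2 * R) ?_ ?_ (by simp) ?_
    · refine Eventually.of_forall fun k => Continuous.aestronglyMeasurable ?_
      have := (hw k).continuous
      fun_prop
    · refine Eventually.of_forall fun k => Eventually.of_forall fun z hz => ?_
      rw [Set.uIoc_of_le P.hz.le] at hz
      have hz' := Set.Ioc_subset_Icc_self hz
      have h1 := hM k z hz'
      rw [norm_mul, norm_pow, Complex.norm_real, norm_norm, Real.norm_eq_abs]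
      exact mul_le_mul (pow_le_pow_left₀ (abs_nonneg _) h1 2) (hR z hz') (norm_nonneg _)
        (sq_nonneg _)
    · have : ∀ᵐ z : ℝ, z ≠ P.zb j := by simp [ae_iff]
      filter_upwards [this] with z hz1 hz
      rw [Set.uIoc_of_le P.hz.le] at hz
      have h1 := hlim z (Set.Ioc_subset_Icc_self hz) hz1
      simpa using (h1.norm.pow 2).mul_const (P.r z)
  rw [intervalIntegral.integral_zero] at hT
  obtain ⟨k, hk⟩ := (hT.eventually_lt_const (pow_pos hε 2)).exists
  refine ⟨w k, hw k, (hdat k).1, ?_, fun o' ho' => ?_, ?_⟩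
  · rw [(hdat k).2.1, mul_div_cancel₀ _ (P.hppos _ (zb_mem j)).ne']
  · have : o' = o := by omega
    subst this
    exact (hdat k).2.2
  · exact Real.sqrt_le_iff.2 ⟨hε.le, hk.le⟩

theorem wron_sub_eq {u v w s : ℝ → ℂ} {j : Fin 2}
    (h : ∀ o ≠ j, wron u v w s (P.zb o) = 0) :
    ‖wron u v w s P.z2 - wron u v w s P.z1‖ = ‖wron u v w s (P.zb j)‖ := by
  fin_cases j
  · have := h 1 (by simp)
    simp only [zb, Matrix.cons_val_one, Matrix.cons_val_zero] at this
    simp [zb, this]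
  · have := h 0 (by simp)
    simp only [zb, Matrix.cons_val_zero] at this
    simp [zb, this]

/-- Boundary values of solutions are small compared to `l` times their `L²` norm. -/
theorem exists_norm_bdB_le (P : SLP) (j : Fin 2) {ε : ℝ} (hε : 0 < ε) :
    ∃ K : ℝ, ∀ (l : ℂ) (u v : ℝ → ℂ), P.IsSol l u v →
      ‖P.bdB j u v‖ ≤ (K + ‖l‖ * ε) * P.nrm u := by
  obtain ⟨w, hw, hwj, hsj, hwo, hwn⟩ := P.exists_small_data j hε
  have hpc := continuous_p (P := P)
  have hqc := continuous_q (P := P)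
  have hrc := continuous_r (P := P)
  have hwc := hw.continuous
  set s : ℝ → ℝ := fun z => P.p z * deriv w z with hs
  have hs1 : ContDiff ℝ 1 s :=
    (P.hp.of_le (by norm_num)).mul ((contDiff_succ_iff_deriv (n := 1)).1 hw).2.2
  have hs' : Continuous (deriv s) := hs1.continuous_deriv le_rfl
  set k : ℝ → ℂ := fun z => ((deriv s z - P.q z * w z) / P.r z : ℝ) with hk
  have hkc : ContinuousOn k (Set.Icc P.z1 P.z2) :=
    Complex.continuous_ofReal.comp_continuousOn (ContinuousOn.div
      (Continuous.continuousOn (by fun_prop)) hrc.continuousOn fun z hz => (P.hrpos z hz).ne')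
  refine ⟨P.nrm k, fun l u v h => ?_⟩
  have hI := integral_wron (w := fun z => (w z : ℂ)) (s := fun z => (s z : ℂ))
    (g := fun z => ((deriv s z : ℝ) : ℂ)) h (fun z hz => ?_) (fun z _ => ?_)
    (Continuous.continuousOn (by fun_prop)) (Set.left_mem_Icc.2 P.hz.le)
    (Set.right_mem_Icc.2 P.hz.le)
  · have hB : P.bdB j u v = wron u v (fun z => (w z : ℂ)) (fun z => (s z : ℂ)) (P.zb j) := by
      simp only [bdB, wron, hwj, hs, hsj]
      ring
    have hW := wron_sub_eq (P := P) (j := j) (u := u) (v := v) (w := fun z => (w z : ℂ))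
      (s := fun z => (s z : ℂ)) fun o ho => by simp [wron, hs, hwo o ho]
    rw [hB, ← hW, ← hI]
    have hsplit : ∫ z in P.z1..P.z2, (u z * ((deriv s z : ℝ) : ℂ) -
        (P.q z - l * P.r z) * u z * (w z : ℂ)) =
        (∫ z in P.z1..P.z2, u z * k z * P.r z) +
          l * ∫ z in P.z1..P.z2, u z * (w z : ℂ) * P.r z := by
      rw [← intervalIntegral.integral_const_mul, ← intervalIntegral.integral_add]
      · refine intervalIntegral.integral_congr fun z hz => ?_
        rw [Set.uIcc_of_le P.hz.le] at hz
        have hr0 : (P.r z : ℂ) ≠ 0 := Complex.ofReal_ne_zero.2 (P.hrpos z hz).ne'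
        simp only [hk]
        push_cast
        field_simp
        ring
      · refine ContinuousOn.intervalIntegrable ?_
        rw [Set.uIcc_of_le P.hz.le]
        exact (h.continuousOn.1.mul hkc).mul (Continuous.continuousOn (by fun_prop))
      · refine ContinuousOn.intervalIntegrable ?_
        rw [Set.uIcc_of_le P.hz.le]
        exact continuousOn_const.mul ((h.continuousOn.1.mul (Continuous.continuousOn
          (by fun_prop))).mul (Continuous.continuousOn (by fun_prop)))
    rw [hsplit]
    have e1 := norm_integral_mul_le h.continuousOn.1 hkc
    have e2 := norm_integral_mul_le (P := P) (g := fun z => (w z : ℂ)) h.continuousOn.1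
      (Continuous.continuousOn (by fun_prop))
    have hn := nrm_nonneg (P := P) u
    calc _ ≤ P.nrm u * P.nrm k + ‖l‖ * (P.nrm u * P.nrm (fun z => (w z : ℂ))) := by
          refine (norm_add_le _ _).trans (add_le_add e1 ?_)
          rw [norm_mul]
          gcongr
      _ ≤ P.nrm u * P.nrm k + ‖l‖ * (P.nrm u * ε) := by gcongr
      _ = _ := by ring
  · have h1 := (hw.differentiable (by norm_num) z).hasDerivAt.ofReal_comp
    refine h1.congr_deriv ?_
    simp only [hs]
    push_cast
    rw [mul_div_cancel_left₀ _ (p_ne_zero hz)]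
  · exact (hs1.differentiable (by norm_num) z).hasDerivAt.ofReal_comp

/-- The bilinear version of the inner product, on pairs `(φ, p φ')`. -/
def bil (P : SLP) (u v w s : ℝ → ℂ) : ℂ :=
  (∫ z in P.z1..P.z2, u z * w z * P.r z) +
    ∑ j, (P.D j : ℂ)⁻¹ * (P.bdC j u v * P.bdC j w s)

/-- Indicator of the nondegenerate eigenvalue-dependent boundaries. -/
def eff (P : SLP) (j : Fin 2) : ℝ := if P.D j = 0 then 0 else 1

/-- Residual in the boundary condition at `z_j`, the `l`-dependent part being dropped if
`D_j = 0`. -/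
def bdX (P : SLP) (j : Fin 2) (l : ℂ) (u v : ℝ → ℂ) : ℂ :=
  -P.bdB j u v - P.eff j * l * P.bdC j u v

theorem sgn_mul_self (j : Fin 2) : P.sgn j * P.sgn j = 1 := by
  fin_cases j <;> simp [sgn]

theorem D_eq (j : Fin 2) : P.D j = P.sgn j * (P.a j * P.d j - P.b j * P.c j) := rfl

theorem det_eq_zero {j : Fin 2} (hD : P.D j = 0) : P.a j * P.d j - P.b j * P.c j = 0 := by
  have h := sgn_mul_self (P := P) j
  have h2 := D_eq (P := P) j
  calc _ = P.sgn j * P.sgn j * (P.a j * P.d j - P.b j * P.c j) := by rw [h, one_mul]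
    _ = P.sgn j * P.D j := by rw [h2]; ring
    _ = 0 := by rw [hD, mul_zero]

theorem bdB_mul_bdC_sub (j : Fin 2) (u v w s : ℝ → ℂ) :
    P.bdB j u v * P.bdC j w s - P.bdC j u v * P.bdB j w s =
      -(P.sgn j * P.D j) * wron u v w s (P.zb j) := by
  have h : (P.sgn j : ℂ) * P.sgn j = 1 := by exact_mod_cast sgn_mul_self (P := P) j
  simp only [bdB, bdC, wron, D_eq]
  push_cast
  linear_combination (P.a j * P.d j - P.b j * P.c j : ℂ) *
    (u (P.zb j) * s (P.zb j) - v (P.zb j) * w (P.zb j)) * h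

/-- The pair `(a_j + ε l c_j, b_j + ε l d_j)` does not vanish. -/
theorem coeff_ne_zero (j : Fin 2) (l : ℂ) :
    ¬ ((P.a j + P.eff j * l * P.c j : ℂ) = 0 ∧ (P.b j + P.eff j * l * P.d j : ℂ) = 0) := by
  rintro ⟨h1, h2⟩
  by_cases hD : P.D j = 0
  · simp only [eff, hD, if_true, Complex.ofReal_zero, zero_mul, add_zero,
      Complex.ofReal_eq_zero] at h1 h2
    exact P.hab j (by rw [h1, h2])
  · simp only [eff, hD, if_false, Complex.ofReal_one, one_mul] at h1 h2
    have h3 : (P.a j * P.d j - P.b j * P.c j : ℂ) = 0 := by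
      linear_combination (P.d j : ℂ) * h1 - P.c j * h2
    have h4 : P.a j * P.d j - P.b j * P.c j = 0 := by exact_mod_cast h3
    exact hD (by rw [D_eq, h4, mul_zero])

theorem bdX_eq (j : Fin 2) (l : ℂ) (u v : ℝ → ℂ) :
    P.bdX j l u v = (P.b j + P.eff j * l * P.d j) * v (P.zb j) -
      (P.a j + P.eff j * l * P.c j) * u (P.zb j) := by
  simp only [bdX, bdB, bdC]
  ring

theorem exists_smul_of_mul_eq {A B x y : ℂ} (h : ¬ (A = 0 ∧ B = 0)) (hxy : B * y - A * x = 0) :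
    ∃ k, x = k * B ∧ y = k * A := by
  by_cases hA : A = 0
  · have hB : B ≠ 0 := fun hB => h ⟨hA, hB⟩
    have hy : y = 0 := by simpa [hA, hB] using hxy
    exact ⟨x / B, by field_simp, by simp [hA, hy]⟩
  · refine ⟨y / A, ?_, by field_simp⟩
    field_simp
    linear_combination (-1 : ℂ) * hxy

theorem wron_eq_zero_of_bdB {j : Fin 2} {u v w s : ℝ → ℂ} (h : P.bdB j u v = 0)
    (h' : P.bdB j w s = 0) : wron u v w s (P.zb j) = 0 := by
  have hab : ¬ ((P.a j : ℂ) = 0 ∧ (P.b j : ℂ) = 0) := by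
    rintro ⟨h1, h2⟩
    rw [Complex.ofReal_eq_zero] at h1 h2
    exact P.hab j (by rw [h1, h2])
  simp only [bdB] at h h'
  obtain ⟨k, h1, h2⟩ := exists_smul_of_mul_eq (x := u (P.zb j)) (y := v (P.zb j)) hab
    (by linear_combination -h)
  obtain ⟨k', h3, h4⟩ := exists_smul_of_mul_eq (x := w (P.zb j)) (y := s (P.zb j)) hab
    (by linear_combination -h')
  rw [wron, h1, h2, h3, h4]
  ring

theorem bdX_of_D_eq_zero {j : Fin 2} (hD : P.D j = 0) (l : ℂ) (u v : ℝ → ℂ) :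
    P.bdX j l u v = -P.bdB j u v := by
  simp [bdX, eff, hD]

theorem bdX_of_D_ne_zero {j : Fin 2} (hD : P.D j ≠ 0) (l : ℂ) (u v : ℝ → ℂ) :
    P.bdX j l u v = -P.bdB j u v - l * P.bdC j u v := by
  simp [bdX, eff, hD]

theorem sgn_wron_add {j : Fin 2} (hD : P.D j ≠ 0) (l m : ℂ) (u v w s : ℝ → ℂ) :
    -(P.sgn j * wron u v w s (P.zb j)) +
      (l - m) * ((P.D j : ℂ)⁻¹ * (P.bdC j u v * P.bdC j w s)) =
      (P.D j : ℂ)⁻¹ * (P.bdC j u v * P.bdX j m w s - P.bdX j l u v * P.bdC j w s) := by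
  have hD' : (P.D j : ℂ) ≠ 0 := Complex.ofReal_ne_zero.2 hD
  have h := bdB_mul_bdC_sub (P := P) j u v w s
  rw [bdX_of_D_ne_zero hD, bdX_of_D_ne_zero hD]
  field_simp
  linear_combination -h

theorem sgn_wron_add_eq_zero {j : Fin 2} {l m : ℂ} {u v w s : ℝ → ℂ}
    (h : P.bdX j l u v = 0) (h' : P.bdX j m w s = 0) :
    -(P.sgn j * wron u v w s (P.zb j)) +
      (l - m) * ((P.D j : ℂ)⁻¹ * (P.bdC j u v * P.bdC j w s)) = 0 := by
  by_cases hD : P.D j = 0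
  · rw [bdX_of_D_eq_zero hD, neg_eq_zero] at h h'
    rw [wron_eq_zero_of_bdB h h', hD]
    simp
  · rw [sgn_wron_add hD, h, h']
    simp

theorem wron_sub (u v w s : ℝ → ℂ) : wron u v w s P.z2 - wron u v w s P.z1 =
    ∑ j, -(P.sgn j * wron u v w s (P.zb j)) := by
  simp [Fin.sum_univ_two, sgn, zb]
  ring

theorem IsSol.sub_mul_bil_eq_sum {l m : ℂ} {u v w s : ℝ → ℂ} (h : P.IsSol l u v)
    (h' : P.IsSol m w s) : (l - m) * P.bil u v w s =
      ∑ j, (-(P.sgn j * wron u v w s (P.zb j)) +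
        (l - m) * ((P.D j : ℂ)⁻¹ * (P.bdC j u v * P.bdC j w s))) := by
  rw [bil, mul_add, h.lagrange h' (Set.left_mem_Icc.2 P.hz.le) (Set.right_mem_Icc.2 P.hz.le),
    wron_sub, Finset.sum_add_distrib, Finset.mul_sum]

/-- Lagrange's identity, boundary terms included. -/
theorem IsSol.sub_mul_bil {l m : ℂ} {u v w s : ℝ → ℂ} (h : P.IsSol l u v)
    (h' : P.IsSol m w s) {i : Fin 2} (hD : P.D i ≠ 0) (hX : ∀ j ≠ i, P.bdX j l u v = 0)
    (hX' : ∀ j ≠ i, P.bdX j m w s = 0) :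
    (l - m) * P.bil u v w s =
      (P.D i : ℂ)⁻¹ * (P.bdC i u v * P.bdX i m w s - P.bdX i l u v * P.bdC i w s) := by
  rw [h.sub_mul_bil_eq_sum h', Finset.sum_eq_single i, sgn_wron_add hD]
  · exact fun j _ hj => sgn_wron_add_eq_zero (hX j hj) (hX' j hj)
  · simp

theorem bdX_smul (j : Fin 2) (l k : ℂ) (w s : ℝ → ℂ) :
    P.bdX j l (fun z => k * w z) (fun z => k * s z) = k * P.bdX j l w s := by
  simp only [bdX_eq]
  ring

theorem bdC_smul (j : Fin 2) (k : ℂ) (w s : ℝ → ℂ) :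
    P.bdC j (fun z => k * w z) (fun z => k * s z) = k * P.bdC j w s := by
  simp only [bdC]
  ring

theorem bdX_conj (j : Fin 2) (l : ℂ) (u v : ℝ → ℂ) :
    P.bdX j (starRingEnd ℂ l) (fun z => starRingEnd ℂ (u z)) (fun z => starRingEnd ℂ (v z)) =
      starRingEnd ℂ (P.bdX j l u v) := by
  simp [bdX_eq]

theorem bdC_conj (j : Fin 2) (u v : ℝ → ℂ) :
    P.bdC j (fun z => starRingEnd ℂ (u z)) (fun z => starRingEnd ℂ (v z)) =
      starRingEnd ℂ (P.bdC j u v) := by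
  simp [bdC]

/-- A continuous family of solutions satisfying the boundary condition at `z_o`. -/
theorem exists_sol_family (P : SLP) (o : Fin 2) : ∃ u v : ℂ → ℝ → ℂ,
    (Continuous fun x : ℂ × ℝ => u x.1 x.2) ∧ (Continuous fun x : ℂ × ℝ => v x.1 x.2) ∧
    ∀ l, P.IsSol l (u l) (v l) ∧ P.bdX o l (u l) (v l) = 0 ∧
      ¬ (u l (P.zb o) = 0 ∧ v l (P.zb o) = 0) ∧
      ∀ w s, P.IsSol l w s → P.bdX o l w s = 0 →
        ∃ k, ∀ z ∈ Set.Icc P.z1 P.z2, w z = k * u l z ∧ s z = k * v l z := by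
  obtain ⟨u, v, hu, hv, h⟩ := exists_sol P (P.zb o)
    (α := fun l => P.b o + P.eff o * l * P.d o) (β := fun l => P.a o + P.eff o * l * P.c o)
    (by fun_prop) (by fun_prop)
  refine ⟨u, v, hu, hv, fun l => ?_⟩
  obtain ⟨h1, h2, h3⟩ := h l
  refine ⟨h3, ?_, ?_, fun w s hws hX => ?_⟩
  · rw [bdX_eq, h1, h2]
    ring
  · rw [h1, h2]
    exact fun hh => coeff_ne_zero o l hh.symm
  · rw [bdX_eq] at hX
    obtain ⟨k, hk1, hk2⟩ := exists_smul_of_mul_eq (coeff_ne_zero o l) hX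
    refine ⟨k, fun z hz => ?_⟩
    have h4 := (hws.sub_smul h3 k).eq_zero (zb_mem o) (by rw [hk1, h1, sub_self])
      (by rw [hk2, h2, sub_self]) hz
    exact ⟨sub_eq_zero.1 h4.1, sub_eq_zero.1 h4.2⟩

theorem bdC_eq_zero_of_D {j : Fin 2} (hD : P.D j = 0) {u v : ℝ → ℂ} (h : P.bdB j u v = 0) :
    P.bdC j u v = 0 := by
  have h1 := det_eq_zero hD
  have h2 : (P.a j * P.d j - P.b j * P.c j : ℂ) = 0 := by exact_mod_cast h1
  simp only [bdB] at h
  simp only [bdC]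
  have e1 : (P.a j : ℂ) * (P.c j * u (P.zb j) - P.d j * v (P.zb j)) = 0 := by
    linear_combination (P.c j : ℂ) * h - v (P.zb j) * h2
  have e2 : (P.b j : ℂ) * (P.c j * u (P.zb j) - P.d j * v (P.zb j)) = 0 := by
    linear_combination (P.d j : ℂ) * h - u (P.zb j) * h2
  rcases mul_eq_zero.1 e1 with ha | ha
  · rcases mul_eq_zero.1 e2 with hb | hb
    · rw [Complex.ofReal_eq_zero] at ha hb
      exact absurd (by rw [ha, hb]) (P.hab j)
    · exact hb
  · exact ha

theorem IsSol.isEigenvalue_of_bdX {l : ℂ} {u v : ℝ → ℂ} (h : P.IsSol l u v) {c : ℝ}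
    (hc : c ∈ Set.Icc P.z1 P.z2) (hne : ¬ (u c = 0 ∧ v c = 0))
    (hX : ∀ j, P.bdX j l u v = 0) : P.IsEigenvalue l := by
  refine h.isEigenvalue hc hne fun j => ?_
  have h1 := hX j
  by_cases hD : P.D j = 0
  · rw [bdX_of_D_eq_zero hD, neg_eq_zero] at h1
    rw [h1, bdC_eq_zero_of_D hD h1, neg_zero, mul_zero]
  · rw [bdX_of_D_ne_zero hD, sub_eq_zero] at h1
    exact h1

theorem continuous_bil {Λ : Type*} [TopologicalSpace Λ] {u v w s : Λ → ℝ → ℂ}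
    (hu : Continuous fun x : Λ × ℝ => u x.1 x.2) (hv : Continuous fun x : Λ × ℝ => v x.1 x.2)
    (hw : Continuous fun x : Λ × ℝ => w x.1 x.2) (hs : Continuous fun x : Λ × ℝ => s x.1 x.2) :
    Continuous fun l => P.bil (u l) (v l) (w l) (s l) := by
  have hr := continuous_r (P := P)
  have hev : ∀ {f : Λ → ℝ → ℂ} (_ : Continuous fun x : Λ × ℝ => f x.1 x.2) (z : ℝ),
      Continuous fun l => f l z := fun hf z => hf.comp (by fun_prop : Continuous fun l => (l, z))
  refine Continuous.add ?_ (continuous_finsetSum _ fun j _ => ?_)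
  · refine intervalIntegral.continuous_parametric_intervalIntegral_of_continuous
      (f := fun l z => u l z * w l z * P.r z) ?_ continuous_const
    exact (hu.mul hw).mul (Complex.continuous_ofReal.comp (hr.comp continuous_snd))
  · have h1 := hev hu (P.zb j)
    have h2 := hev hv (P.zb j)
    have h3 := hev hw (P.zb j)
    have h4 := hev hs (P.zb j)
    simp only [bdC]
    fun_prop

/-- The quadratic form of the (indefinite) inner product. -/
def quad (P : SLP) (u v : ℝ → ℂ) : ℝ :=
  P.nrm u ^ 2 + ∑ j, (P.D j)⁻¹ * ‖P.bdC j u v‖ ^ 2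

theorem bil_conj (u v : ℝ → ℂ) :
    P.bil u v (fun z => starRingEnd ℂ (u z)) (fun z => starRingEnd ℂ (v z)) = P.quad u v := by
  rw [bil, quad, nrm_sq]
  push_cast
  rw [← intervalIntegral.integral_ofReal]
  congr 1
  · refine intervalIntegral.integral_congr fun z _ => ?_
    simp [Complex.mul_conj']
  · refine Finset.sum_congr rfl fun j _ => ?_
    rw [bdC_conj, Complex.mul_conj']

theorem exists_norm_bdB_le_mul (P : SLP) {η : ℝ} (hη : 0 < η) : ∃ R₀ : ℝ, 1 ≤ R₀ ∧
    ∀ (j : Fin 2) (l : ℂ) (u v : ℝ → ℂ), R₀ ≤ ‖l‖ → P.IsSol l u v →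
      ‖P.bdB j u v‖ ≤ η * ‖l‖ * P.nrm u := by
  have h := fun j => exists_norm_bdB_le P j (half_pos hη)
  choose K hK using h
  refine ⟨1 + 2 * |K 0| / η + 2 * |K 1| / η, ?_, fun j l u v hl hs => ?_⟩
  · have := abs_nonneg (K 0)
    have := abs_nonneg (K 1)
    have h1 : 0 ≤ 2 * |K 0| / η := by positivity
    have h2 : 0 ≤ 2 * |K 1| / η := by positivity
    linarith
  · refine (hK j l u v hs).trans (mul_le_mul_of_nonneg_right ?_ (nrm_nonneg u))
    have h1 : 0 ≤ 2 * |K 0| / η := by positivity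
    have h2 : 0 ≤ 2 * |K 1| / η := by positivity
    have h3 : 2 * |K j| / η ≤ ‖l‖ := by
      fin_cases j <;> simp only [Fin.zero_eta, Fin.mk_one, Fin.isValue] <;> linarith
    rw [div_le_iff₀ hη] at h3
    have := le_abs_self (K j)
    linarith

/-- For large `‖l‖` the quadratic form is bounded below on solutions, up to the residuals in the
boundary conditions. -/
theorem exists_le_quad (P : SLP) : ∃ R₀ M : ℝ, 1 ≤ R₀ ∧ 0 ≤ M ∧
    ∀ (l : ℂ) (u v : ℝ → ℂ) (x : ℝ), R₀ ≤ ‖l‖ → P.IsSol l u v →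
      (∀ j, P.D j ≠ 0 → ‖P.bdX j l u v‖ ≤ x) →
      P.nrm u ^ 2 / 2 - M * (x / ‖l‖) ^ 2 ≤ P.quad u v ∧
      ∀ j, P.D j ≠ 0 → ‖P.bdC j u v‖ ≤ x / ‖l‖ + P.nrm u := by
  set M : ℝ := ∑ j, |(P.D j)⁻¹| with hM
  have hM0 : 0 ≤ M := Finset.sum_nonneg fun j _ => abs_nonneg _
  set η : ℝ := 1 / (1 + 4 * M) with hη
  have hη0 : 0 < η := by positivity
  have hη1 : η ≤ 1 := by
    rw [hη, div_le_one (by positivity)]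
    linarith
  have hηM : 4 * M * η ≤ 1 := by
    rw [hη, mul_one_div, div_le_one (by positivity)]
    linarith
  obtain ⟨R₀, hR₀, hB⟩ := exists_norm_bdB_le_mul P hη0
  refine ⟨R₀, 2 * M, hR₀, by positivity, fun l u v x hl hs hX => ?_⟩
  have hl0 : 0 < ‖l‖ := by linarith
  have hn := nrm_nonneg (P := P) u
  set y := x / ‖l‖ with hy
  have hC : ∀ j, P.D j ≠ 0 → ‖P.bdC j u v‖ ≤ y + η * P.nrm u := by
    intro j hD
    have h1 : l * P.bdC j u v = -P.bdX j l u v - P.bdB j u v := by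
      rw [bdX_of_D_ne_zero hD]
      ring
    have h2 : ‖l‖ * ‖P.bdC j u v‖ ≤ x + η * ‖l‖ * P.nrm u := by
      rw [← norm_mul, h1]
      refine (norm_sub_le _ _).trans (add_le_add ?_ (hB j l u v hl hs))
      rw [norm_neg]
      exact hX j hD
    have h3 : x = ‖l‖ * y := by
      rw [hy]
      field_simp
    rw [h3] at h2
    refine le_of_mul_le_mul_left ?_ hl0
    linarith
  refine ⟨?_, fun j hD => (hC j hD).trans (by nlinarith)⟩
  have h4 : ∀ j, -(|(P.D j)⁻¹| * (2 * y ^ 2 + 2 * η * P.nrm u ^ 2)) ≤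
      (P.D j)⁻¹ * ‖P.bdC j u v‖ ^ 2 := by
    intro j
    by_cases hD : P.D j = 0
    · simp [hD]
    have h5 : ‖P.bdC j u v‖ ^ 2 ≤ 2 * y ^ 2 + 2 * η * P.nrm u ^ 2 := by
      have h6 := pow_le_pow_left₀ (norm_nonneg _) (hC j hD) 2
      have h7 : η ^ 2 * P.nrm u ^ 2 ≤ η * P.nrm u ^ 2 :=
        mul_le_mul_of_nonneg_right (by nlinarith) (sq_nonneg _)
      nlinarith [sq_nonneg (y - η * P.nrm u)]
    have h8 := mul_le_mul_of_nonneg_left h5 (abs_nonneg (P.D j)⁻¹)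
    have h9 : -|(P.D j)⁻¹| * ‖P.bdC j u v‖ ^ 2 ≤ (P.D j)⁻¹ * ‖P.bdC j u v‖ ^ 2 :=
      mul_le_mul_of_nonneg_right (neg_abs_le _) (sq_nonneg _)
    linarith
  have h10 := Finset.sum_le_sum (fun j (_ : j ∈ Finset.univ) => h4 j)
  rw [Finset.sum_neg_distrib, ← Finset.sum_mul, ← hM] at h10
  rw [quad]
  have h11 : 4 * M * η * P.nrm u ^ 2 ≤ P.nrm u ^ 2 :=
    (mul_le_mul_of_nonneg_right hηM (sq_nonneg _)).trans (one_mul _).le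
  nlinarith

/-- Bound for solutions with normalized residual at `z_i`. -/
theorem exists_norm_bdC_le (P : SLP) {i : Fin 2} (hD : P.D i ≠ 0) : ∃ R₀ C : ℝ, 1 ≤ R₀ ∧
    ∀ (l : ℂ) (u v : ℝ → ℂ), R₀ ≤ ‖l‖ → l.im ≠ 0 → P.IsSol l u v →
      (∀ j ≠ i, P.bdX j l u v = 0) → P.bdX i l u v = 1 →
      P.nrm u ≤ C / |l.im| ∧ ‖(P.D i : ℂ)⁻¹ * P.bdC i u v‖ ≤ C / |l.im| := by
  obtain ⟨R₀, M, hR₀, hM, h⟩ := exists_le_quad P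
  set δ : ℝ := |(P.D i)⁻¹| with hδ
  have hδ0 : 0 ≤ δ := abs_nonneg _
  set C₁ : ℝ := 2 * M + 4 * δ + 1 with hC₁
  have hC₁0 : 0 < C₁ := by positivity
  refine ⟨R₀, C₁ + δ * (1 + C₁), hR₀, fun l u v hl him hs hX hXi => ?_⟩
  have ht : 0 < |l.im| := abs_pos.2 him
  have htl : |l.im| ≤ ‖l‖ := Complex.abs_im_le_norm l
  have hn := nrm_nonneg (P := P) u
  obtain ⟨h1, h2⟩ := h l u v 1 hl hs fun j _ => by
    by_cases hj : j = i
    · rw [hj, hXi, norm_one]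
    · rw [hX j hj, norm_zero]
      exact zero_le_one
  have h2 := h2 i hD
  have h3 : 1 / ‖l‖ ≤ 1 / |l.im| := one_div_le_one_div_of_le ht htl
  have h30 : 0 ≤ 1 / ‖l‖ := by positivity
  have h4 := hs.sub_mul_bil hs.conj hD hX fun j hj => by rw [bdX_conj, hX j hj, map_zero]
  rw [bil_conj, bdX_conj, bdC_conj, hXi, map_one, Complex.sub_conj] at h4
  have h5 : 2 * |l.im| * |P.quad u v| ≤ δ * (2 * ‖P.bdC i u v‖) := by
    have h6 := congrArg norm h4
    have h7 : ‖P.bdC i u v * 1 - 1 * (starRingEnd ℂ) (P.bdC i u v)‖ ≤ 2 * ‖P.bdC i u v‖ := by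
      refine (norm_sub_le _ _).trans ?_
      rw [mul_one, one_mul, RCLike.norm_conj]
      linarith
    have h8 : ‖(P.D i : ℂ)⁻¹‖ = δ := by
      rw [← Complex.ofReal_inv, Complex.norm_real, Real.norm_eq_abs]
    rw [norm_mul, norm_mul, norm_mul, h8, Complex.norm_I, Complex.norm_real, Complex.norm_real,
      Real.norm_eq_abs, Real.norm_eq_abs, abs_mul, abs_two, mul_one] at h6
    rw [h6]
    exact mul_le_mul_of_nonneg_left h7 hδ0
  set t := |l.im| with htdef
  set n := P.nrm u with hndef
  have h6 : t * (1 / ‖l‖) ≤ 1 := by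
    rw [mul_one_div, div_le_one (by linarith)]
    exact htl
  have h7 : t * ‖P.bdC i u v‖ ≤ 1 + t * n := by
    have := mul_le_mul_of_nonneg_left h2 ht.le
    linarith
  have h8 : (t * n) ^ 2 ≤ 2 * M + 2 * δ * (1 + t * n) := by
    have h9 : t ^ 2 * (n ^ 2 / 2 - M * (1 / ‖l‖) ^ 2) ≤ t * (δ * ‖P.bdC i u v‖) := by
      have := (h1.trans (le_abs_self _))
      have h10 := mul_le_mul_of_nonneg_left this (sq_nonneg t)
      have h11 := mul_le_mul_of_nonneg_left h5 ht.le
      linarith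
    have h12 : (t * (1 / ‖l‖)) ^ 2 ≤ 1 := pow_le_one₀ (by positivity) h6
    have h13 := mul_le_mul_of_nonneg_left h12 hM
    have h14 := mul_le_mul_of_nonneg_left h7 hδ0
    linarith
  have h9 : t * n ≤ C₁ := by
    by_contra hcon
    push Not at hcon
    have h0 : 0 < t * n := hC₁0.trans hcon
    nlinarith
  constructor
  · rw [le_div_iff₀ ht]
    have : 0 ≤ δ * (1 + C₁) := by positivity
    linarith
  · rw [norm_mul, ← Complex.ofReal_inv, Complex.norm_real, Real.norm_eq_abs, ← hδ,
      le_div_iff₀ ht]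
    have := mul_le_mul_of_nonneg_left (h7.trans (add_le_add_right h9 1)) hδ0
    linarith

theorem bil_congr_left {u v u' v' w s : ℝ → ℂ} {k : ℂ}
    (h : ∀ z ∈ Set.Icc P.z1 P.z2, u' z = k * u z ∧ v' z = k * v z) :
    P.bil u' v' w s = k * P.bil u v w s := by
  rw [bil, bil, mul_add, Finset.mul_sum, ← intervalIntegral.integral_const_mul]
  congr 1
  · refine intervalIntegral.integral_congr fun z hz => ?_
    rw [Set.uIcc_of_le P.hz.le] at hz
    simp only [(h z hz).1]
    ring
  · refine Finset.sum_congr rfl fun j _ => ?_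
    simp only [bdC, (h _ (zb_mem j)).1, (h _ (zb_mem j)).2]
    ring

theorem bil_comm (u v w s : ℝ → ℂ) : P.bil u v w s = P.bil w s u v := by
  simp only [bil, mul_comm]

theorem quad_eq_bil {w s : ℝ → ℂ} (hw : ∀ z, starRingEnd ℂ (w z) = w z)
    (hs : ∀ z, starRingEnd ℂ (s z) = s z) : (P.quad w s : ℂ) = P.bil w s w s := by
  rw [← bil_conj]
  simp only [hw, hs]

theorem exists_forall_ne (i : Fin 2) : ∃ o : Fin 2, o ≠ i ∧ ∀ j, j ≠ i → j = o := by
  fin_cases i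
  · exact ⟨1, by decide, by decide⟩
  · exact ⟨0, by decide, by decide⟩

/-- The unit series at a nondegenerate boundary point. -/
theorem tendsto_sum_of_D_ne_zero {i : Fin 2} (hD : P.D i ≠ 0) {lam : ℕ → ℝ} {w s : ℕ → ℝ → ℂ}
    (hmono : StrictMono lam) (htop : Tendsto lam atTop atTop)
    (hsol : ∀ n, P.IsSol (lam n) (w n) (s n)) (hX : ∀ n j, P.bdX j (lam n) (w n) (s n) = 0)
    (hall : ∀ l : ℂ, P.IsEigenvalue l → ∃ n, l = lam n)
    (hw : ∀ n z, starRingEnd ℂ (w n z) = w n z) (hs : ∀ n z, starRingEnd ℂ (s n z) = s n z)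
    (hq : ∀ n, P.quad (w n) (s n) ≠ 0) :
    Tendsto (fun N => ∑ n ∈ Finset.range N, ‖P.bdC i (w n) (s n)‖ ^ 2 / P.quad (w n) (s n))
      atTop (𝓝 (P.D i)) := by
  have hD' : (P.D i : ℂ) ≠ 0 := Complex.ofReal_ne_zero.2 hD
  obtain ⟨o, ho, hoj⟩ := exists_forall_ne i
  obtain ⟨u, v, hu, hv, hχ⟩ := exists_sol_family P o
  have hχX : ∀ l, ∀ j ≠ i, P.bdX j l (u l) (v l) = 0 := fun l j hj => by
    rw [hoj j hj]
    exact (hχ l).2.1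
  set ω : ℂ → ℂ := fun l => P.bdX i l (u l) (v l) with hω
  have huz : ∀ z, Continuous fun l => u l z := fun z =>
    hu.comp (by fun_prop : Continuous fun l : ℂ => (l, z))
  have hvz : ∀ z, Continuous fun l => v l z := fun z =>
    hv.comp (by fun_prop : Continuous fun l : ℂ => (l, z))
  have hωc : Continuous ω := by
    have h1 := huz (P.zb i)
    have h2 := hvz (P.zb i)
    simp only [hω, bdX_eq]
    fun_prop
  have hCc : Continuous fun l => P.bdC i (u l) (v l) := by
    have h1 := huz (P.zb i)
    have h2 := hvz (P.zb i)
    simp only [bdC]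
    fun_prop
  have hω0 : ∀ l, ω l = 0 → ∃ n, l = lam n := fun l hl =>
    hall l ((hχ l).1.isEigenvalue_of_bdX (zb_mem o) (hχ l).2.2.1 fun j => by
      by_cases hj : j = i
      · rw [hj]
        exact hl
      · exact hχX l j hj)
  set f : ℂ → ℂ := fun l => (P.D i : ℂ)⁻¹ * P.bdC i (u l) (v l) / ω l with hf
  set a : ℕ → ℝ := fun n => (P.D i)⁻¹ ^ 2 * (‖P.bdC i (w n) (s n)‖ ^ 2 / P.quad (w n) (s n)) with ha
  have hY : ∀ l, ω l ≠ 0 → ∃ y y' : ℝ → ℂ, P.IsSol l y y' ∧ (∀ j ≠ i, P.bdX j l y y' = 0) ∧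
      P.bdX i l y y' = 1 ∧ (P.D i : ℂ)⁻¹ * P.bdC i y y' = f l := fun l hl =>
    ⟨_, _, (hχ l).1.smul (ω l)⁻¹, fun j hj => by rw [bdX_smul, hχX l j hj, mul_zero], by
      rw [bdX_smul]; exact inv_mul_cancel₀ hl, by rw [bdC_smul, hf]; ring⟩
  have him : ∀ l : ℂ, l.im ≠ 0 → ω l ≠ 0 := fun l hl h0 => by
    obtain ⟨n, rfl⟩ := hω0 l h0
    exact hl (Complex.ofReal_im _)
  obtain ⟨R₀, C, hR₀, hb⟩ := exists_norm_bdC_le P hD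
  have key : Tendsto (fun N => ∑ n ∈ Finset.range N, a n) atTop (𝓝 (P.D i)⁻¹) := by
    refine tendsto_sum_of_resolvent_bound (f := f) (C := C) (R₀ := R₀) hmono htop ?_ ?_ ?_ ?_ ?_
    · intro z hz
      have hωz : ω z ≠ 0 := fun h0 => by
        obtain ⟨n, hn⟩ := hω0 z h0
        exact hz n hn
      have hbc : Continuous fun l => P.bil (u l) (v l) (u z) (v z) :=
        continuous_bil hu hv (hu.comp (by fun_prop : Continuous fun x : ℂ × ℝ => (z, x.2)))
          (hv.comp (by fun_prop : Continuous fun x : ℂ × ℝ => (z, x.2)))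
      refine (hasDerivAt_iff_tendsto_slope.2 (?_ : Tendsto _ _
        (𝓝 (P.bil (u z) (v z) (u z) (v z) / (ω z * ω z))))).differentiableAt
      have h1 : Tendsto (fun l => P.bil (u l) (v l) (u z) (v z) / (ω l * ω z)) (𝓝[≠] z)
          (𝓝 (P.bil (u z) (v z) (u z) (v z) / (ω z * ω z))) :=
        ((hbc.tendsto z).div ((hωc.tendsto z).mul_const _)
          (mul_ne_zero hωz hωz)).mono_left nhdsWithin_le_nhds
      refine h1.congr' ?_
      filter_upwards [self_mem_nhdsWithin,
        nhdsWithin_le_nhds ((hωc.tendsto z).eventually_ne hωz)] with l hl hωl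
      have h2 : (l - z) * P.bil (u l) (v l) (u z) (v z) = (P.D i : ℂ)⁻¹ *
          (P.bdC i (u l) (v l) * ω z - ω l * P.bdC i (u z) (v z)) :=
        (hχ l).1.sub_mul_bil (hχ z).1 hD (hχX l) (hχX z)
      have hlz : l - z ≠ 0 := sub_ne_zero.2 hl
      rw [slope_def_field, div_eq_div_iff (mul_ne_zero hωl hωz) hlz]
      simp only [hf]
      rw [mul_comm _ (l - z), h2]
      field_simp
    · intro n
      obtain ⟨k, hk⟩ := (hχ (lam n)).2.2.2 (w n) (s n) (hsol n) (hX n o)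
      have hbc : Continuous fun l => P.bil (u l) (v l) (w n) (s n) := by
        have h1 : Continuous fun l => P.bil (u (lam n)) (v (lam n)) (u l) (v l) :=
          continuous_bil (hu.comp (by fun_prop : Continuous fun x : ℂ × ℝ => ((lam n : ℂ), x.2)))
            (hv.comp (by fun_prop : Continuous fun x : ℂ × ℝ => ((lam n : ℂ), x.2))) hu hv
        refine (h1.const_mul k).congr fun l => ?_
        rw [← bil_congr_left hk, bil_comm]
      have hb0 : k * P.bil (u (lam n)) (v (lam n)) (w n) (s n) = P.quad (w n) (s n) := by
        rw [← bil_congr_left hk, quad_eq_bil (hw n) (hs n)]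
      have hCk : P.bdC i (w n) (s n) = k * P.bdC i (u (lam n)) (v (lam n)) := by
        simp only [bdC, (hk _ (zb_mem i)).1, (hk _ (zb_mem i)).2]
        ring
      have hqc : (P.quad (w n) (s n) : ℂ) ≠ 0 := Complex.ofReal_ne_zero.2 (hq n)
      have hk0 : k ≠ 0 := left_ne_zero_of_mul (hb0 ▸ hqc)
      have hbn : P.bil (u (lam n)) (v (lam n)) (w n) (s n) ≠ 0 :=
        right_ne_zero_of_mul (hb0 ▸ hqc)
      have hCr : (P.bdC i (w n) (s n)) ^ 2 = (‖P.bdC i (w n) (s n)‖ ^ 2 : ℝ) := by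
        push_cast
        rw [← Complex.mul_conj', ← bdC_conj]
        simp only [hw, hs, sq]
      have hlim : -(a n : ℂ) = -((P.D i : ℂ)⁻¹ ^ 2 * P.bdC i (u (lam n)) (v (lam n)) *
          P.bdC i (w n) (s n) / P.bil (u (lam n)) (v (lam n)) (w n) (s n)) := by
        simp only [ha, Complex.ofReal_mul, Complex.ofReal_div, ← hCr, ← hb0]
        push_cast
        rw [hCk]
        field_simp
      rw [hlim]
      have h1 : Tendsto (fun l => -((P.D i : ℂ)⁻¹ ^ 2 * P.bdC i (u l) (v l) *
          P.bdC i (w n) (s n) / P.bil (u l) (v l) (w n) (s n))) (𝓝[≠] (lam n : ℂ)) _ :=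
        (((((hCc.tendsto _).const_mul _).mul_const _).div (hbc.tendsto _) hbn).neg).mono_left
          nhdsWithin_le_nhds
      refine h1.congr' ?_
      filter_upwards [self_mem_nhdsWithin,
        nhdsWithin_le_nhds ((hbc.tendsto _).eventually_ne hbn)] with l hl hbl
      have hll : l - lam n ≠ 0 := sub_ne_zero.2 hl
      have h2 : (l - lam n) * P.bil (u l) (v l) (w n) (s n) = (P.D i : ℂ)⁻¹ *
          (P.bdC i (u l) (v l) * P.bdX i (lam n) (w n) (s n) - ω l * P.bdC i (w n) (s n)) :=
        (hχ l).1.sub_mul_bil (hsol n) hD (hχX l) fun j _ => hX n j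
      rw [hX n i, mul_zero, zero_sub] at h2
      have hωl : ω l ≠ 0 := fun h0 => by
        rw [h0, zero_mul, neg_zero, mul_zero] at h2
        exact mul_ne_zero hll hbl h2
      have h3 : l - lam n = -((P.D i : ℂ)⁻¹ * (ω l * P.bdC i (w n) (s n))) /
          P.bil (u l) (v l) (w n) (s n) := by
        rw [eq_div_iff hbl, h2]
        ring
      rw [h3]
      simp only [hf]
      field_simp
    · intro l hl hli
      obtain ⟨y, y', h1, h2, h3, h4⟩ := hY l (him l hli)
      rw [← h4]
      exact (hb l y y' hl hli h1 h2 h3).2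
    · intro θ hθ
      rw [Metric.tendsto_atTop]
      intro ε hε
      set A := ‖(P.D i : ℂ)⁻¹‖ * (|C| / |Real.sin θ|) with hA
      have hA0 : 0 ≤ A := by positivity
      obtain ⟨R₁, -, hB⟩ := exists_norm_bdB_le_mul P (η := ε / (1 + A)) (by positivity)
      refine ⟨max R₀ R₁, fun R hR => ?_⟩
      have hR0 : R₀ ≤ R := (le_max_left _ _).trans hR
      have hRpos : 0 < R := by linarith
      set l := circleMap 0 R θ with hl
      have hln : ‖l‖ = R := by
        rw [hl, norm_circleMap_zero, abs_of_pos hRpos]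
      have hli : l.im = R * Real.sin θ := by
        simp [hl, circleMap_zero, Complex.exp_ofReal_mul_I_im]
      have hli0 : l.im ≠ 0 := by
        rw [hli]
        exact mul_ne_zero hRpos.ne' hθ
      obtain ⟨y, y', h1, h2, h3, h4⟩ := hY l (him l hli0)
      have h5 := (hb l y y' (by rw [hln]; exact hR0) hli0 h1 h2 h3).1
      have h6 := hB i l y y' (by rw [hln]; exact (le_max_right _ _).trans hR) h1
      have h7 : -l * f l - ((P.D i)⁻¹ : ℝ) = (P.D i : ℂ)⁻¹ * P.bdB i y y' := by
        rw [bdX_of_D_ne_zero hD] at h3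
        rw [← h4]
        push_cast
        linear_combination (P.D i : ℂ)⁻¹ * h3
      rw [dist_eq_norm, h7, norm_mul]
      have h8 : ‖P.bdB i y y'‖ ≤ ε / (1 + A) * (|C| / |Real.sin θ|) := by
        refine h6.trans ?_
        rw [hln, mul_assoc]
        refine mul_le_mul_of_nonneg_left ?_ (by positivity)
        calc R * P.nrm y ≤ R * (C / |l.im|) := mul_le_mul_of_nonneg_left h5 hRpos.le
          _ = C / |Real.sin θ| := by
            rw [hli, abs_mul, abs_of_pos hRpos]
            field_simp
          _ ≤ |C| / |Real.sin θ| := by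
            gcongr
            exact le_abs_self C
      calc _ ≤ ‖(P.D i : ℂ)⁻¹‖ * (ε / (1 + A) * (|C| / |Real.sin θ|)) :=
            mul_le_mul_of_nonneg_left h8 (norm_nonneg _)
        _ = ε * (A / (1 + A)) := by
          rw [hA]
          ring
        _ < ε * 1 := by
          refine mul_lt_mul_of_pos_left ?_ hε
          rw [div_lt_one (by positivity)]
          linarith
        _ = ε := mul_one ε
    · obtain ⟨R₁, M, -, -, h⟩ := exists_le_quad P
      filter_upwards [htop.eventually_ge_atTop R₁] with n hn
      have h1 := (h (lam n) (w n) (s n) 0 (by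
        rw [Complex.norm_real]
        exact hn.trans (le_abs_self _)) (hsol n) fun j _ => by rw [hX n j, norm_zero]).1
      rw [zero_div, zero_pow two_ne_zero, mul_zero, sub_zero] at h1
      have h2 : 0 ≤ P.quad (w n) (s n) := (by positivity : 0 ≤ P.nrm (w n) ^ 2 / 2).trans h1
      simp only [ha]
      positivity
  have h := key.const_mul (P.D i ^ 2)
  have h1 : P.D i ^ 2 * (P.D i)⁻¹ = P.D i := by
    field_simp
  rw [h1] at h
  refine h.congr fun N => ?_
  simp only [ha]
  rw [Finset.mul_sum]
  refine Finset.sum_congr rfl fun n _ => ?_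
  field_simp

end SLP

theorem exists_mem_Ioo_eq_zero {g G H : ℝ → ℝ} {x y : ℝ} (hxy : x < y) (hG : Continuous G)
    (hH : Continuous H) (h : ∀ t, g t = (t - x) * G t) (h' : ∀ t, g t = (t - y) * H t)
    (hx : 0 < G x) (hy : 0 < H y) : ∃ t ∈ Set.Ioo x y, g t = 0 := by
  have hg : Continuous g := by
    rw [funext h]
    fun_prop
  obtain ⟨t₁, h1, h1x, h1y⟩ := ((((hG.tendsto x).eventually_const_lt hx).filter_mono
    nhdsWithin_le_nhds).and (Ioo_mem_nhdsGT (show x < (x + y) / 2 by linarith))).exists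
  obtain ⟨t₂, h2, h2x, h2y⟩ := ((((hH.tendsto y).eventually_const_lt hy).filter_mono
    nhdsWithin_le_nhds).and (Ioo_mem_nhdsLT (show (x + y) / 2 < y by linarith))).exists
  have h3 : 0 ≤ g t₁ := by
    rw [h]
    exact (mul_pos (by linarith) h1).le
  have h4 : g t₂ ≤ 0 := by
    rw [h']
    exact (mul_neg_of_neg_of_pos (by linarith) h2).le
  obtain ⟨t, ht, ht0⟩ := intermediate_value_Icc' (by linarith) hg.continuousOn
    (show (0 : ℝ) ∈ Set.Icc (g t₂) (g t₁) from ⟨h4, h3⟩)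
  exact ⟨t, ⟨by linarith [ht.1], by linarith [ht.2]⟩, ht0⟩

namespace SLP

variable {P : SLP}

theorem ab_ne_zero (j : Fin 2) : ¬ ((P.a j : ℂ) = 0 ∧ (P.b j : ℂ) = 0) := by
  rintro ⟨h1, h2⟩
  rw [Complex.ofReal_eq_zero] at h1 h2
  exact P.hab j (by rw [h1, h2])

theorem exists_eq_mul_of_bdB {j : Fin 2} {w s : ℝ → ℂ} (h : P.bdB j w s = 0) :
    ∃ k : ℂ, w (P.zb j) = k * P.b j ∧ s (P.zb j) = k * P.a j :=
  exists_smul_of_mul_eq (ab_ne_zero j) (by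
    simp only [bdB] at h
    linear_combination -h)

theorem wron_of_eq_mul {j : Fin 2} {u v w s : ℝ → ℂ} {k : ℂ} (hw : w (P.zb j) = k * P.b j)
    (hs : s (P.zb j) = k * P.a j) : wron u v w s (P.zb j) = k * P.bdB j u v := by
  rw [wron, hw, hs, bdB]
  ring

/-- At a degenerate boundary, the functional `B_j` can be nonzero for one eigenvalue at most. -/
theorem bdB_eq_zero_of_ne {j : Fin 2} (hD : P.D j = 0) {l m : ℂ} (hlm : l ≠ m)
    {u v w s : ℝ → ℂ} (h : -P.bdB j u v = l * P.bdC j u v) (h' : -P.bdB j w s = m * P.bdC j w s)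
    (hB : P.bdB j u v ≠ 0) : P.bdB j w s = 0 := by
  have h1 := bdB_mul_bdC_sub (P := P) j u v w s
  rw [hD, Complex.ofReal_zero, mul_zero, neg_zero, zero_mul] at h1
  have hC : P.bdC j u v ≠ 0 := fun h0 => hB (by rw [h0, mul_zero, neg_eq_zero] at h; exact h)
  have h2 : (l - m) * P.bdC j u v * P.bdB j w s = 0 := by
    linear_combination m * h1 - P.bdB j w s * h + P.bdB j u v * h'
  exact (mul_eq_zero.1 h2).resolve_left (mul_ne_zero (sub_ne_zero.2 hlm) hC)

theorem bil_eq_zero_of_data {l : ℂ} {w s : ℝ → ℂ} (h : P.IsSol l w s) {c : ℝ}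
    (hc : c ∈ Set.Icc P.z1 P.z2) (hw : w c = 0) (hs : s c = 0) : P.bil w s w s = 0 := by
  rw [bil_congr_left (k := 0) (u := 0) (v := 0), zero_mul]
  intro z hz
  have := h.eq_zero hc hw hs hz
  simp [this.1, this.2]

/-- If both boundaries are degenerate, two eigenvalues whose eigenfunctions are regular and
orthogonal to the same irregular function are separated by another eigenvalue. -/
theorem exists_isEigenvalue_between (hD : ∀ j, P.D j = 0) {x y : ℝ} (hxy : x < y)
    {f g : ℝ → ℂ} (hf : ∀ j, P.bdB j f g ≠ 0)
    (h : ∀ t : ℝ, t = x ∨ t = y → ∃ w s, P.IsSol t w s ∧ (∀ j, P.bdB j w s = 0) ∧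
      P.bil w s w s ≠ 0 ∧ wron f g w s P.z2 = wron f g w s P.z1) :
    ∃ t ∈ Set.Ioo x y, P.IsEigenvalue (t : ℂ) := by
  obtain ⟨u, v, hu, hv, hχ⟩ := exists_sol P (P.zb 0) (continuous_const (y := (P.b 0 : ℂ)))
    (continuous_const (y := (P.a 0 : ℂ)))
  have hzb0 : P.zb 0 = P.z1 := rfl
  have hzb1 : P.zb 1 = P.z2 := rfl
  have hreal : ∀ t : ℝ, ∀ z ∈ Set.Icc P.z1 P.z2, starRingEnd ℂ (u t z) = 1 * u t z ∧
      starRingEnd ℂ (v t z) = 1 * v t z := by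
    intro t z hz
    obtain ⟨h1, h2, h3⟩ := hχ t
    have h4 := h3.conj
    rw [Complex.conj_ofReal] at h4
    have h5 := (h4.sub_smul h3 1).eq_zero (zb_mem 0) (by simp [h1]) (by simp [h2]) hz
    exact ⟨sub_eq_zero.1 h5.1, sub_eq_zero.1 h5.2⟩
  set κ : ℂ := P.bdB 0 f g / P.bdB 1 f g with hκ
  have hκ0 : κ ≠ 0 := div_ne_zero (hf 0) (hf 1)
  have hbilD : ∀ u v w s : ℝ → ℂ, P.bil u v w s = ∫ z in P.z1..P.z2, u z * w z * P.r z := by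
    intro u v w s
    simp [bil, hD]
  have hbr : ∀ l t : ℝ, starRingEnd ℂ (P.bil (u l) (v l) (u t) (v t)) =
      P.bil (u l) (v l) (u t) (v t) := by
    intro l t
    rw [hbilD, ← intervalIntegral.intervalIntegral_conj]
    refine intervalIntegral.integral_congr fun z hz => ?_
    rw [Set.uIcc_of_le P.hz.le] at hz
    simp [(hreal l z hz).1, (hreal t z hz).1]
  have key : ∀ t : ℝ, t = x ∨ t = y → 0 < (P.bil (u t) (v t) (u t) (v t)).re ∧
      ∀ l : ℝ, ((l - t : ℝ) : ℂ) * P.bil (u l) (v l) (u t) (v t) = κ * P.bdB 1 (u l) (v l) := by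
    intro t ht
    obtain ⟨w, s, hs, hB, hq, hW⟩ := h t ht
    obtain ⟨h1, h2, h3⟩ := hχ t
    obtain ⟨k, hk1, hk2⟩ := exists_eq_mul_of_bdB (hB 0)
    have hk : ∀ z ∈ Set.Icc P.z1 P.z2, w z = k * u t z ∧ s z = k * v t z := fun z hz => by
      have h4 := (hs.sub_smul h3 k).eq_zero (zb_mem 0) (by rw [hk1, h1, sub_self])
        (by rw [hk2, h2, sub_self]) hz
      exact ⟨sub_eq_zero.1 h4.1, sub_eq_zero.1 h4.2⟩
    have hb : P.bil w s w s = k * (k * P.bil (u t) (v t) (u t) (v t)) := by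
      rw [bil_congr_left hk, bil_comm, bil_congr_left hk]
    rw [hb] at hq
    have hk0 := left_ne_zero_of_mul hq
    have hb0 := right_ne_zero_of_mul (right_ne_zero_of_mul hq)
    have hquad : (P.quad (u t) (v t) : ℂ) = P.bil (u t) (v t) (u t) (v t) := by
      rw [← bil_conj, bil_comm, bil_congr_left (hreal t), one_mul]
    have hpos : 0 < P.quad (u t) (v t) := by
      refine lt_of_le_of_ne ?_ fun h0 => hb0 (by rw [← hquad, ← h0, Complex.ofReal_zero])
      simp only [quad, hD, inv_zero, zero_mul, Finset.sum_const_zero, add_zero]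
      positivity
    refine ⟨by rwa [← hquad, Complex.ofReal_re], fun l => ?_⟩
    have hB1 : P.bdB 1 (u t) (v t) = 0 := by
      have h5 := hB 1
      have h6 : P.bdB 1 w s = k * P.bdB 1 (u t) (v t) := by
        simp only [bdB, (hk _ (zb_mem 1)).1, (hk _ (zb_mem 1)).2]
        ring
      rw [h6] at h5
      exact (mul_eq_zero.1 h5).resolve_left hk0
    obtain ⟨k', hk1', hk2'⟩ := exists_eq_mul_of_bdB hB1
    have hk' : k' = κ := by
      rw [← hzb0, ← hzb1, wron_of_eq_mul (k := k * k') (by rw [(hk _ (zb_mem 1)).1, hk1', mul_assoc])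
        (by rw [(hk _ (zb_mem 1)).2, hk2', mul_assoc]), wron_of_eq_mul hk1 hk2, mul_assoc] at hW
      rw [hκ, eq_div_iff (hf 1)]
      exact mul_left_cancel₀ hk0 hW
    have h6 := (hχ l).2.2.lagrange h3 (Set.left_mem_Icc.2 P.hz.le) (Set.right_mem_Icc.2 P.hz.le)
    rw [← hbilD (u l) (v l) (u t) (v t), ← hzb0, ← hzb1, wron_of_eq_mul hk1' hk2',
      wron_of_eq_mul (k := 1) (by rw [h1, one_mul]) (by rw [h2, one_mul]), hk'] at h6
    rw [Complex.ofReal_sub, h6, bdB, bdB, (hχ l).1, (hχ l).2.1]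
    ring
  have hcont : ∀ t : ℝ, Continuous fun l : ℝ => (P.bil (u l) (v l) (u t) (v t)).re := by
    intro t
    have h1 : Continuous fun l => P.bil (u l) (v l) (u t) (v t) :=
      continuous_bil hu hv (hu.comp (by fun_prop : Continuous fun x : ℂ × ℝ => ((t : ℂ), x.2)))
        (hv.comp (by fun_prop : Continuous fun x : ℂ × ℝ => ((t : ℂ), x.2)))
    exact Complex.continuous_re.comp (h1.comp Complex.continuous_ofReal)
  obtain ⟨hx, hx'⟩ := key x (Or.inl rfl)
  obtain ⟨hy, hy'⟩ := key y (Or.inr rfl)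
  obtain ⟨t, ht, h0⟩ := exists_mem_Ioo_eq_zero (g := fun l : ℝ => (κ * P.bdB 1 (u l) (v l)).re)
    hxy (hcont x) (hcont y) (fun l => by rw [← hx' l, Complex.re_ofReal_mul])
    (fun l => by rw [← hy' l, Complex.re_ofReal_mul]) hx hy
  have h1 : κ * P.bdB 1 (u t) (v t) = 0 := by
    refine Complex.ext h0 ?_
    rw [← hx' t, Complex.im_ofReal_mul, Complex.conj_eq_iff_im.1 (hbr t x), mul_zero,
      Complex.zero_im]
  obtain ⟨h2, h3, h4⟩ := hχ t
  refine ⟨t, ht, h4.isEigenvalue_of_bdX (zb_mem 0) ?_ fun j => ?_⟩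
  · rw [h2, h3]
    exact fun hh => ab_ne_zero 0 hh.symm
  · rw [bdX_of_D_eq_zero (hD j), neg_eq_zero]
    fin_cases j
    · simp only [Fin.zero_eta, Fin.isValue, bdB, h2, h3]
      ring
    · exact (mul_eq_zero.1 h1).resolve_left hκ0

/-- Eigenfunctions satisfy `B_j φ = 0` at degenerate boundaries. -/
theorem bdX_eq_zero {lam : ℕ → ℝ} {w s : ℕ → ℝ → ℂ} (hmono : StrictMono lam)
    (hsol : ∀ n, P.IsSol (lam n) (w n) (s n))
    (hbc : ∀ n j, -P.bdB j (w n) (s n) = lam n * P.bdC j (w n) (s n))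
    (hall : ∀ l : ℂ, P.IsEigenvalue l → ∃ n, l = lam n)
    (horth : ∀ m n, m ≠ n → P.bil (w m) (s m) (w n) (s n) = 0)
    (hq : ∀ n, P.bil (w n) (s n) (w n) (s n) ≠ 0) (m : ℕ) (j : Fin 2) :
    P.bdX j (lam m) (w m) (s m) = 0 := by
  by_contra hXm
  have hlam : ∀ n, n ≠ m → (lam m : ℂ) ≠ lam n := fun n hn h =>
    hn (hmono.injective (Complex.ofReal_injective h.symm))
  have hXD : ∀ n j, P.D j ≠ 0 → P.bdX j (lam n) (w n) (s n) = 0 := fun n j hD => by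
    rw [bdX_of_D_ne_zero hD, hbc, sub_self]
  have hone : ∀ n n' j, n ≠ n' → P.bdX j (lam n) (w n) (s n) ≠ 0 →
      P.bdX j (lam n') (w n') (s n') = 0 := by
    intro n n' j hn h
    have hD : P.D j = 0 := not_not.1 fun hD => h (hXD n j hD)
    rw [bdX_of_D_eq_zero hD] at h ⊢
    rw [bdB_eq_zero_of_ne hD (fun h => hn (hmono.injective (Complex.ofReal_injective h)))
      (hbc n j) (hbc n' j) (neg_ne_zero.1 h), neg_zero]
  have hDj : P.D j = 0 := not_not.1 fun hD => hXm (hXD m j hD)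
  obtain ⟨o, ho, hoj⟩ := exists_forall_ne j
  by_cases hXo : P.bdX o (lam m) (w m) (s m) = 0
  · obtain ⟨n, hnm, hn⟩ : ∃ n, n ≠ m ∧ P.bdX o (lam n) (w n) (s n) = 0 := by
      by_cases h : P.bdX o (lam (m + 1)) (w (m + 1)) (s (m + 1)) = 0
      · exact ⟨m + 1, by omega, h⟩
      · exact ⟨m + 2, by omega, hone _ _ o (by omega) h⟩
    have h1 := (hsol m).sub_mul_bil_eq_sum (hsol n)
    rw [horth m n hnm.symm, mul_zero, Finset.sum_eq_single j
      (fun j' _ hj' => by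
        rw [hoj j' hj']
        exact sgn_wron_add_eq_zero hXo hn) (by simp), hDj] at h1
    have h2 := hone m n j hnm.symm hXm
    rw [bdX_of_D_eq_zero hDj, neg_eq_zero] at h2
    rw [bdX_of_D_eq_zero hDj] at hXm
    obtain ⟨k, hk1, hk2⟩ := exists_eq_mul_of_bdB h2
    rw [wron_of_eq_mul hk1 hk2] at h1
    have hsgn : (P.sgn j : ℂ) ≠ 0 := fun h0 => by
      have := sgn_mul_self (P := P) j
      rw [Complex.ofReal_eq_zero.1 h0] at this
      simp at this
    have hk : k = 0 := by
      by_contra hk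
      refine mul_ne_zero hsgn (mul_ne_zero hk (neg_ne_zero.1 hXm)) ?_
      simpa using h1
    exact hq n (bil_eq_zero_of_data (hsol n) (zb_mem j) (by rw [hk1, hk, zero_mul])
      (by rw [hk2, hk, zero_mul]))
  · have hall' : ∀ j', P.bdX j' (lam m) (w m) (s m) ≠ 0 := fun j' => by
      by_cases h : j' = j
      · rwa [h]
      · rwa [hoj j' h]
    have hD : ∀ j', P.D j' = 0 := fun j' => not_not.1 fun hD => hall' j' (hXD m j' hD)
    have hreg : ∀ n, n ≠ m → ∀ j', P.bdB j' (w n) (s n) = 0 := fun n hn j' => by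
      have := hone m n j' hn.symm (hall' j')
      rwa [bdX_of_D_eq_zero (hD j'), neg_eq_zero] at this
    have hW : ∀ n, n ≠ m → wron (w m) (s m) (w n) (s n) P.z2 =
        wron (w m) (s m) (w n) (s n) P.z1 := fun n hn => by
      have h1 := (hsol m).lagrange (hsol n) (Set.left_mem_Icc.2 P.hz.le)
        (Set.right_mem_Icc.2 P.hz.le)
      have h2 := horth m n hn.symm
      simp only [bil, hD, Complex.ofReal_zero, inv_zero, zero_mul, Finset.sum_const_zero,
        add_zero] at h2
      rw [h2, mul_zero] at h1
      exact sub_eq_zero.1 h1.symm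
    obtain ⟨t, ht, hE⟩ := exists_isEigenvalue_between hD
      (hmono (show m + 1 < m + 2 by omega)) (f := w m) (g := s m)
      (fun j' h0 => hall' j' (by rw [bdX_of_D_eq_zero (hD j'), h0, neg_zero])) fun t ht => by
        rcases ht with rfl | rfl
        · exact ⟨_, _, hsol (m + 1), hreg _ (by omega), hq _, hW _ (by omega)⟩
        · exact ⟨_, _, hsol (m + 2), hreg _ (by omega), hq _, hW _ (by omega)⟩
    obtain ⟨n, hn⟩ := hall t hE
    rw [Complex.ofReal_injective hn] at ht
    have h1 := hmono.lt_iff_lt.1 ht.1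
    have h2 := hmono.lt_iff_lt.1 ht.2
    omega

theorem assoc_zb {i : Fin 2} (hi : P.inS i) (φ : ℝ → ℂ) : P.assoc φ (P.zb i) = P.Cop i φ := by
  have h : P.zb 1 ≠ P.zb 0 := P.hz.ne'
  fin_cases i
  · simp_all [assoc]
  · simp_all [assoc]

theorem assoc_of_mem_Ioo {z : ℝ} (hz : z ∈ Set.Ioo P.z1 P.z2) (φ : ℝ → ℂ) :
    P.assoc φ z = φ z := by
  have h0 : z ≠ P.zb 0 := hz.1.ne'
  have h1 : z ≠ P.zb 1 := hz.2.ne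
  simp [assoc, h0, h1]

theorem Cop_of_not_inS {j : Fin 2} (hj : ¬ P.inS j) (φ : ℝ → ℂ) : P.Cop j φ = 0 := by
  simp only [inS, ne_eq, not_not, Prod.mk.injEq] at hj
  simp [Cop, hj.1, hj.2]

theorem deriv_eq_conj {φ : ℝ → ℂ} (hφ : ∀ z, starRingEnd ℂ (φ z) = φ z) (z : ℝ) :
    starRingEnd ℂ (deriv φ z) = deriv φ z := by
  have h : (fun z => star (φ z)) = φ := funext hφ
  have h1 := deriv.star (f := φ) (x := z)
  rw [h] at h1
  exact h1.symm

theorem inp_assoc {φ ψ : ℝ → ℂ} (hφ : ∀ z, starRingEnd ℂ (φ z) = φ z) :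
    P.inp (P.assoc φ) (P.assoc ψ) = P.bil φ (fun w => (P.p w : ℂ) * deriv φ w) ψ
      (fun w => (P.p w : ℂ) * deriv ψ w) := by
  have hC : ∀ j, starRingEnd ℂ (P.Cop j φ) = P.Cop j φ := fun j => by
    simp [Cop, hφ, deriv_eq_conj hφ]
  rw [inp, bil]
  congr 1
  · rw [intervalIntegral.integral_of_le P.hz.le, intervalIntegral.integral_of_le P.hz.le,
      integral_Ioc_eq_integral_Ioo, integral_Ioc_eq_integral_Ioo]
    refine setIntegral_congr_fun measurableSet_Ioo fun z hz => ?_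
    simp only [assoc_of_mem_Ioo hz, hφ]
  · rw [Sfin, Finset.sum_filter]
    refine Finset.sum_congr rfl fun j _ => ?_
    change _ = (P.D j : ℂ)⁻¹ * (P.Cop j φ * P.Cop j ψ)
    split_ifs with hj
    · rw [assoc_zb hj, assoc_zb hj, hC, mul_assoc]
    · rw [Cop_of_not_inS hj, zero_mul, mul_zero]

end SLP

/-- **unit series.** For each `i ∈ S`, the series
`Σ_n |Φ_n(z_i)|²/⟨Φ_n,Φ_n⟩` converges and its sum equals `D_i`. -/
theorem statement_8 (P : SLP)
    (hdef : P.RightDefinite ∨ (P.LeftDefinite ∧ ¬ P.IsEigenvalue 0))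
    (lam : ℕ → ℝ) (φ : ℕ → ℝ → ℂ)
    (hmono : StrictMono lam)
    (htop : Tendsto lam atTop atTop)
    (heig : ∀ n : ℕ, P.IsEigenpair (lam n) (φ n))
    (hrealφ : ∀ (n : ℕ) (z : ℝ), (φ n z).im = 0)
    (hall : ∀ μc : ℂ, P.IsEigenvalue μc → ∃ n : ℕ, μc = (lam n : ℂ))
    (horth : ∀ m n : ℕ, m ≠ n → P.inp (P.assoc (φ m)) (P.assoc (φ n)) = 0)
    (hnorm : ∀ n : ℕ,
      P.inp (P.assoc (φ n)) (P.assoc (φ n)) = 1 ∨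
      P.inp (P.assoc (φ n)) (P.assoc (φ n)) = -1)
    (i : Fin 2) (hi : P.inS i) :
    Tendsto
      (fun N : ℕ => ∑ n ∈ Finset.range N,
        ((Complex.normSq (P.assoc (φ n) (P.zb i)) : ℂ) /
          P.inp (P.assoc (φ n)) (P.assoc (φ n))))
      atTop (nhds ((P.D i : ℂ))) := by
  have hconj : ∀ n z, starRingEnd ℂ (φ n z) = φ n z := fun n z =>
    Complex.conj_eq_iff_im.2 (hrealφ n z)
  set s : ℕ → ℝ → ℂ := fun n w => (P.p w : ℂ) * deriv (φ n) w with hs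
  have hsconj : ∀ n z, starRingEnd ℂ (s n z) = s n z := fun n z => by
    simp only [hs, map_mul, Complex.conj_ofReal, SLP.deriv_eq_conj (hconj n)]
  have hinp : ∀ m n, P.inp (P.assoc (φ m)) (P.assoc (φ n)) = P.bil (φ m) (s m) (φ n) (s n) :=
    fun m n => SLP.inp_assoc (hconj m)
  have hbil : ∀ n, P.bil (φ n) (s n) (φ n) (s n) ≠ 0 := fun n h => by
    have := hnorm n
    rw [hinp, h] at this
    norm_num at this
  have hsol : ∀ n, P.IsSol (lam n) (φ n) (s n) := fun n => (heig n).isSol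
  have hX := SLP.bdX_eq_zero hmono hsol (fun n j => (heig n).2.2.2 j) hall
    (fun m n h => by rw [← hinp, horth m n h]) hbil
  have hquad : ∀ n, (P.quad (φ n) (s n) : ℂ) = P.inp (P.assoc (φ n)) (P.assoc (φ n)) :=
    fun n => by rw [SLP.quad_eq_bil (hconj n) (hsconj n), hinp]
  have hassoc : ∀ n, P.assoc (φ n) (P.zb i) = P.bdC i (φ n) (s n) := fun n => SLP.assoc_zb hi _
  by_cases hD : P.D i = 0
  · have h0 : ∀ n, P.bdC i (φ n) (s n) = 0 := fun n => by
      have := hX n i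
      rw [SLP.bdX_of_D_eq_zero hD, neg_eq_zero] at this
      exact SLP.bdC_eq_zero_of_D hD this
    simp [hassoc, h0, hD]
  · have h := SLP.tendsto_sum_of_D_ne_zero hD hmono htop hsol hX hall hconj hsconj fun n h0 =>
      hbil n (by rw [← SLP.quad_eq_bil (hconj n) (hsconj n), h0, Complex.ofReal_zero])
    refine ((Complex.continuous_ofReal.tendsto _).comp h).congr fun N => ?_
    simp only [Function.comp_apply, Complex.ofReal_sum, Complex.ofReal_div, hquad, hassoc,
      Complex.normSq_eq_norm_sq]
end
end

section
/- If (λ, G) solves the quasigeostrophic Rossby-wave eigenvalue problem over a sloping bottom with G not identically zero, then (k² + λ) · ⟨G,G⟩ > 0, where ⟨G,G⟩ = (1/H)( ∫_{z₁}^{z₂} G(z)² dz + γ₁ G(z₁)² ). In particular, eigenfunctions with positive indefinite norm have eigenvalue λ > −k², and eigenfunctions with negative indefinite norm have eigenvalue λ < −k². -/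
open Filter Topology

noncomputable section

/-- If `(λ, G)` solves the quasigeostrophic Rossby-wave
eigenvalue problem over a sloping bottom with `G` not identically zero, then
`(k² + λ)⟨G,G⟩ > 0`, where
`⟨G,G⟩ = (1/H)(∫ G² dz + γ₁ G(z₁)²)`. -/
theorem statement_14 (z1 z2 : ℝ) (hz : z1 < z2)
    (S : ℝ → ℝ) (hS : ContDiff ℝ 1 S)
    (hSpos : ∀ z ∈ Set.Icc z1 z2, 0 < S z)
    (k : ℝ) (hk : 0 < k) (γ1 : ℝ) (hγ : γ1 ≠ 0)
    (lam : ℝ) (G : ℝ → ℝ) (hG : ContDiff ℝ 2 G)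
    (hode : ∀ z ∈ Set.Ioo z1 z2,
      -(deriv (fun w => (S w)⁻¹ * deriv G w) z) = lam * G z)
    (hbc1 : -(k ^ 2) * G z1 - γ1⁻¹ * ((S z1)⁻¹ * deriv G z1) = lam * G z1)
    (hbc2 : deriv G z2 = 0)
    (hnz : ∃ z ∈ Set.Icc z1 z2, G z ≠ 0) :
    0 < (k ^ 2 + lam) *
      ((z2 - z1)⁻¹ * ((∫ z in z1..z2, G z ^ 2) + γ1 * G z1 ^ 2)) := by
  have hG1 : Differentiable ℝ G := hG.differentiable (by norm_num)
  have hG' : ContDiff ℝ 1 (deriv G) := by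
    have h : ContDiff ℝ (1 + 1) G := by simpa [one_add_one_eq_two] using hG
    exact (contDiff_succ_iff_deriv.1 h).2.2
  have hSc : ContinuousOn (fun w => (S w)⁻¹) (Set.Icc z1 z2) :=
    hS.continuous.continuousOn.inv₀ fun z h => (hSpos z h).ne'
  have hG'c : ContinuousOn (deriv G) (Set.Icc z1 z2) := hG'.continuous.continuousOn
  have hGc : ContinuousOn G (Set.Icc z1 z2) := hG.continuous.continuousOn
  have hKc : ContinuousOn (fun z => (S z)⁻¹ * deriv G z ^ 2) (Set.Icc z1 z2) :=
    hSc.mul (hG'c.pow 2)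
  have hKi : IntervalIntegrable (fun z => (S z)⁻¹ * deriv G z ^ 2) MeasureTheory.volume z1 z2 :=
    hKc.intervalIntegrable_of_Icc hz.le
  have hGi : IntervalIntegrable (fun z => lam * G z ^ 2) MeasureTheory.volume z1 z2 :=
    (continuous_const.mul (hG.continuous.pow 2)).intervalIntegrable _ _
  have hderiv : ∀ z ∈ Set.Ioo z1 z2, HasDerivAt (fun w => G w * ((S w)⁻¹ * deriv G w))
      ((S z)⁻¹ * deriv G z ^ 2 - lam * G z ^ 2) z := by
    intro z h
    have hP : DifferentiableAt ℝ (fun w => (S w)⁻¹ * deriv G w) z :=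
      ((hS.differentiable one_ne_zero z).inv (hSpos z (Set.Ioo_subset_Icc_self h)).ne').mul
        (hG'.differentiable one_ne_zero z)
    refine ((hG1 z).hasDerivAt.mul hP.hasDerivAt).congr_deriv ?_
    linear_combination (-G z) * hode z h
  have hparts := intervalIntegral.integral_eq_sub_of_hasDerivAt_of_le hz.le
    (hGc.mul (hSc.mul hG'c)) hderiv (hKi.sub hGi)
  rw [intervalIntegral.integral_sub hKi hGi, intervalIntegral.integral_const_mul] at hparts
  simp only [Pi.mul_apply, hbc2, mul_zero, zero_sub] at hparts
  have hnonneg : 0 ≤ ∫ z in z1..z2, (S z)⁻¹ * deriv G z ^ 2 :=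
    intervalIntegral.integral_nonneg hz.le fun z h =>
      mul_nonneg (inv_nonneg.2 (hSpos z h).le) (sq_nonneg _)
  have hpos : 0 < ∫ z in z1..z2, G z ^ 2 := by
    obtain ⟨c, hc, hGc0⟩ := hnz
    exact intervalIntegral.integral_pos hz (hGc.pow 2) (fun z _ => sq_nonneg _)
      ⟨c, hc, by positivity⟩
  have hbc : γ1 * (k ^ 2 + lam) * G z1 = -((S z1)⁻¹ * deriv G z1) := by
    have h := mul_inv_cancel₀ hγ
    linear_combination (-γ1) * hbc1 - ((S z1)⁻¹ * deriv G z1) * h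
  have henergy : (k ^ 2 + lam) * ((∫ z in z1..z2, G z ^ 2) + γ1 * G z1 ^ 2) =
      k ^ 2 * (∫ z in z1..z2, G z ^ 2) + ∫ z in z1..z2, (S z)⁻¹ * deriv G z ^ 2 := by
    linear_combination G z1 * hbc - hparts
  rw [mul_left_comm, henergy]
  exact mul_pos (inv_pos.2 (sub_pos.2 hz)) (by positivity)
end
end

section
/- If (λ, G) and (λ′, G′) both solve the quasigeostrophic Rossby-wave eigenvalue problem over a sloping bottom and λ ≠ λ′, then the eigenfunctions are orthogonal with respect to the boundary-augmented inner product: ⟨G,G′⟩ = (1/H)( ∫_{z₁}^{z₂} G(z) G′(z) dz + γ₁ G(z₁) G′(z₁) ) = 0. -/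
open Filter Topology

noncomputable section

/-- The flux `S⁻¹ G'` is differentiable wherever `S` does not vanish. -/
theorem differentiableAt_inv_mul_deriv {S G : ℝ → ℝ} (hS : ContDiff ℝ 1 S)
    (hG : ContDiff ℝ 2 G) {z : ℝ} (hz : S z ≠ 0) :
    DifferentiableAt ℝ (fun w => (S w)⁻¹ * deriv G w) z :=
  ((hS.differentiable one_ne_zero z).inv hz).mul
    ((hG.iterate_deriv' 1 1).differentiable one_ne_zero z)

/-- Lagrange's identity for two solutions of the Sturm–Liouville equation
`-(S⁻¹ G')' = λ G`, integrated over an interval. -/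
theorem integral_mul_eq_wronskian_sub {z1 z2 : ℝ} (hz : z1 ≤ z2) {S F G : ℝ → ℝ}
    (hS : ContDiff ℝ 1 S) (hS0 : ∀ z ∈ Set.Icc z1 z2, S z ≠ 0)
    (hF : ContDiff ℝ 2 F) (hG : ContDiff ℝ 2 G) {a b : ℝ}
    (hodeF : ∀ z ∈ Set.Ioo z1 z2,
      -(deriv (fun w => (S w)⁻¹ * deriv F w) z) = a * F z)
    (hodeG : ∀ z ∈ Set.Ioo z1 z2,
      -(deriv (fun w => (S w)⁻¹ * deriv G w) z) = b * G z) :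
    (b - a) * ∫ z in z1..z2, F z * G z =
      ((S z2)⁻¹ * deriv F z2 * G z2 - (S z2)⁻¹ * deriv G z2 * F z2) -
      ((S z1)⁻¹ * deriv F z1 * G z1 - (S z1)⁻¹ * deriv G z1 * F z1) := by
  have dF := hF.differentiable two_ne_zero
  have dG := hG.differentiable two_ne_zero
  rw [← intervalIntegral.integral_const_mul]
  refine intervalIntegral.integral_eq_sub_of_hasDerivAt_of_le
    (f := fun z => (S z)⁻¹ * deriv F z * G z - (S z)⁻¹ * deriv G z * F z) hz ?_ ?_ ?_
  · intro z h
    exact ((((differentiableAt_inv_mul_deriv hS hF (hS0 z h)).mul (dG z)).sub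
      ((differentiableAt_inv_mul_deriv hS hG (hS0 z h)).mul
        (dF z))).continuousAt).continuousWithinAt
  · intro z h
    have h0 := hS0 z (Set.Ioo_subset_Icc_self h)
    have hd := ((differentiableAt_inv_mul_deriv hS hF h0).hasDerivAt.mul (dG z).hasDerivAt).sub
      ((differentiableAt_inv_mul_deriv hS hG h0).hasDerivAt.mul (dF z).hasDerivAt)
    refine hd.congr_deriv ?_
    linear_combination (-G z) * hodeF z h + F z * hodeG z h
  · exact (continuous_const.mul (hF.continuous.mul hG.continuous)).intervalIntegrable _ _

/-- Eigenfunctions of the quasigeostrophic Rossby-wave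
eigenvalue problem over a sloping bottom belonging to distinct eigenvalues
are orthogonal with respect to the boundary-augmented inner product
`⟨G,G′⟩ = (1/H)(∫ G G′ dz + γ₁ G(z₁) G′(z₁))`. -/
theorem statement_15 (z1 z2 : ℝ) (hz : z1 < z2)
    (S : ℝ → ℝ) (hS : ContDiff ℝ 1 S)
    (hSpos : ∀ z ∈ Set.Icc z1 z2, 0 < S z)
    (k : ℝ) (hk : 0 < k) (γ1 : ℝ) (hγ : γ1 ≠ 0)
    (lam lam' : ℝ) (G G' : ℝ → ℝ)
    (hG : ContDiff ℝ 2 G) (hG' : ContDiff ℝ 2 G')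
    (hode : ∀ z ∈ Set.Ioo z1 z2,
      -(deriv (fun w => (S w)⁻¹ * deriv G w) z) = lam * G z)
    (hode' : ∀ z ∈ Set.Ioo z1 z2,
      -(deriv (fun w => (S w)⁻¹ * deriv G' w) z) = lam' * G' z)
    (hbc1 : -(k ^ 2) * G z1 - γ1⁻¹ * ((S z1)⁻¹ * deriv G z1) = lam * G z1)
    (hbc1' : -(k ^ 2) * G' z1 - γ1⁻¹ * ((S z1)⁻¹ * deriv G' z1) = lam' * G' z1)
    (hbc2 : deriv G z2 = 0) (hbc2' : deriv G' z2 = 0)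
    (hne : lam ≠ lam') :
    (z2 - z1)⁻¹ * ((∫ z in z1..z2, G z * G' z) + γ1 * G z1 * G' z1) = 0 := by
  have key := integral_mul_eq_wronskian_sub hz.le hS (fun z h => (hSpos z h).ne') hG hG' hode hode'
  rw [hbc2, hbc2'] at key
  have flux : ∀ p g l : ℝ, -(k ^ 2) * g - γ1⁻¹ * p = l * g → p = -γ1 * (l + k ^ 2) * g := by
    intro p g l h
    field_simp at h
    linear_combination -h
  rw [flux _ _ _ hbc1, flux _ _ _ hbc1'] at key
  have hzero : (∫ z in z1..z2, G z * G' z) + γ1 * G z1 * G' z1 = 0 := by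
    apply mul_left_cancel₀ (sub_ne_zero.mpr hne.symm)
    linear_combination key
  rw [hzero, mul_zero]
end
end

section
/- Suppose γ₁ < 0. If (λ, G) and (λ′, G′) both solve the quasigeostrophic Rossby-wave eigenvalue problem over a sloping bottom, with λ ≠ λ′ and neither G nor G′ identically zero, then at least one of ⟨G,G⟩ > 0 and ⟨G′,G′⟩ > 0 holds. (That is, at most one eigenvalue can carry an eigenfunction of nonpositive indefinite norm; the Pontryagin index of the problem is one.) -/
open Filter Topology

noncomputable section

/-- Green's identity for the eigenvalue problem: `λ ⟨G, F⟩` is the energy form of `G` and `F`. -/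
theorem eigenvalue_mul_inner_eq_energy {z1 z2 : ℝ} (hz : z1 < z2)
    {S : ℝ → ℝ} (hS : ContDiff ℝ 1 S) (hSpos : ∀ z ∈ Set.Icc z1 z2, 0 < S z)
    {k γ1 : ℝ} (hγ : γ1 ≠ 0) {lam : ℝ} {G F : ℝ → ℝ}
    (hG : ContDiff ℝ 2 G) (hF : ContDiff ℝ 1 F)
    (hode : ∀ z ∈ Set.Ioo z1 z2, -(deriv (fun w => (S w)⁻¹ * deriv G w) z) = lam * G z)
    (hbc1 : -(k ^ 2) * G z1 - γ1⁻¹ * ((S z1)⁻¹ * deriv G z1) = lam * G z1)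
    (hbc2 : deriv G z2 = 0) :
    lam * ((∫ z in z1..z2, G z * F z) + γ1 * (G z1 * F z1)) =
      (∫ z in z1..z2, (S z)⁻¹ * (deriv G z * deriv F z)) - γ1 * k ^ 2 * (G z1 * F z1) := by
  have hdG : ContDiff ℝ 1 (deriv G) := ((contDiff_succ_iff_deriv (n := 1)).1 hG).2.2
  have hdF : Continuous (deriv F) := hF.continuous_deriv_one
  have hinv : ContinuousOn (fun z => (S z)⁻¹) (Set.Icc z1 z2) :=
    hS.continuous.continuousOn.inv₀ fun z hzm => (hSpos z hzm).ne'
  have hint : IntervalIntegrable (fun z => G z * F z) MeasureTheory.volume z1 z2 :=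
    (hG.continuous.mul hF.continuous).intervalIntegrable _ _
  have hint' : IntervalIntegrable (fun z => (S z)⁻¹ * (deriv G z * deriv F z))
      MeasureTheory.volume z1 z2 :=
    (hinv.mul (hdG.continuous.mul hdF).continuousOn).intervalIntegrable_of_Icc hz.le
  have key := intervalIntegral.integral_eq_sub_of_hasDerivAt_of_le hz.le
    (f := fun z => (S z)⁻¹ * deriv G z * F z)
    (f' := fun z => (S z)⁻¹ * (deriv G z * deriv F z) - lam * (G z * F z))
    ((hinv.mul hdG.continuous.continuousOn).mul hF.continuous.continuousOn)
    (by
      intro z hzm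
      have hflux : DifferentiableAt ℝ (fun w => (S w)⁻¹ * deriv G w) z :=
        ((hS.differentiable one_ne_zero z).inv (hSpos z (Set.Ioo_subset_Icc_self hzm)).ne').mul
          (hdG.differentiable one_ne_zero z)
      refine (hflux.hasDerivAt.mul (hF.differentiable one_ne_zero z).hasDerivAt).congr_deriv ?_
      linear_combination -F z * hode z hzm)
    (hint'.sub (hint.const_mul lam))
  rw [intervalIntegral.integral_sub hint' (hint.const_mul lam),
    intervalIntegral.integral_const_mul] at key
  simp only [hbc2, mul_zero, zero_mul, zero_sub] at key
  have hflux1 : (S z1)⁻¹ * deriv G z1 = -γ1 * (lam + k ^ 2) * G z1 := by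
    rw [sub_eq_iff_eq_add, ← sub_eq_iff_eq_add', eq_inv_mul_iff_mul_eq₀ hγ] at hbc1
    linear_combination -hbc1
  rw [hflux1] at key
  linear_combination -key

/-- A continuous function, not identically zero, of nonpositive indefinite norm does not vanish at
the lower end. -/
theorem left_ne_zero_of_norm_nonpos {z1 z2 : ℝ} (hz : z1 < z2) {γ1 : ℝ} {G : ℝ → ℝ}
    (hG : Continuous G) (hnz : ∃ z ∈ Set.Icc z1 z2, G z ≠ 0)
    (hle : (∫ z in z1..z2, G z * G z) + γ1 * (G z1 * G z1) ≤ 0) : G z1 ≠ 0 := by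
  intro h0
  obtain ⟨c, hc, hGc⟩ := hnz
  have hpos : 0 < ∫ z in z1..z2, G z * G z :=
    intervalIntegral.integral_pos hz (hG.mul hG).continuousOn
      (fun z _ => mul_self_nonneg (G z)) ⟨c, hc, mul_self_pos.2 hGc⟩
  rw [h0] at hle
  linarith

/-- An eigenfunction of nonpositive indefinite norm has negative norm. -/
theorem norm_neg_of_norm_nonpos {z1 z2 : ℝ} (hz : z1 < z2)
    {S : ℝ → ℝ} (hS : ContDiff ℝ 1 S) (hSpos : ∀ z ∈ Set.Icc z1 z2, 0 < S z)
    {k γ1 : ℝ} (hk : 0 < k) (hγ : γ1 < 0) {lam : ℝ} {G : ℝ → ℝ} (hG : ContDiff ℝ 2 G)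
    (hode : ∀ z ∈ Set.Ioo z1 z2, -(deriv (fun w => (S w)⁻¹ * deriv G w) z) = lam * G z)
    (hbc1 : -(k ^ 2) * G z1 - γ1⁻¹ * ((S z1)⁻¹ * deriv G z1) = lam * G z1)
    (hbc2 : deriv G z2 = 0) (hnz : ∃ z ∈ Set.Icc z1 z2, G z ≠ 0)
    (hle : (∫ z in z1..z2, G z * G z) + γ1 * (G z1 * G z1) ≤ 0) :
    (∫ z in z1..z2, G z * G z) + γ1 * (G z1 * G z1) < 0 := by
  refine lt_of_le_of_ne hle fun h0 => ?_
  have hG1 := left_ne_zero_of_norm_nonpos hz hG.continuous hnz hle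
  have henergy := eigenvalue_mul_inner_eq_energy hz hS hSpos hγ.ne hG (hG.of_le one_le_two)
    hode hbc1 hbc2
  have hint : 0 ≤ ∫ z in z1..z2, (S z)⁻¹ * (deriv G z * deriv G z) :=
    intervalIntegral.integral_nonneg hz.le fun z hzm =>
      mul_nonneg (inv_pos.2 (hSpos z hzm)).le (mul_self_nonneg _)
  have hbdry : 0 < -γ1 * k ^ 2 * (G z1 * G z1) :=
    mul_pos (mul_pos (neg_pos.2 hγ) (pow_pos hk 2)) (mul_self_pos.2 hG1)
  rw [h0, mul_zero] at henergy
  linarith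

/-- Suppose `γ₁ < 0`. If `(λ, G)` and `(λ′, G′)` both solve
the quasigeostrophic Rossby-wave eigenvalue problem over a sloping bottom,
with `λ ≠ λ′` and neither `G` nor `G′` identically zero, then at least one of
`⟨G,G⟩ > 0` and `⟨G′,G′⟩ > 0` holds (the Pontryagin index is one). -/
theorem statement_16 (z1 z2 : ℝ) (hz : z1 < z2)
    (S : ℝ → ℝ) (hS : ContDiff ℝ 1 S)
    (hSpos : ∀ z ∈ Set.Icc z1 z2, 0 < S z)
    (k : ℝ) (hk : 0 < k) (γ1 : ℝ) (hγ : γ1 < 0)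
    (lam lam' : ℝ) (G G' : ℝ → ℝ)
    (hG : ContDiff ℝ 2 G) (hG' : ContDiff ℝ 2 G')
    (hode : ∀ z ∈ Set.Ioo z1 z2,
      -(deriv (fun w => (S w)⁻¹ * deriv G w) z) = lam * G z)
    (hode' : ∀ z ∈ Set.Ioo z1 z2,
      -(deriv (fun w => (S w)⁻¹ * deriv G' w) z) = lam' * G' z)
    (hbc1 : -(k ^ 2) * G z1 - γ1⁻¹ * ((S z1)⁻¹ * deriv G z1) = lam * G z1)
    (hbc1' : -(k ^ 2) * G' z1 - γ1⁻¹ * ((S z1)⁻¹ * deriv G' z1) = lam' * G' z1)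
    (hbc2 : deriv G z2 = 0) (hbc2' : deriv G' z2 = 0)
    (hne : lam ≠ lam')
    (hnz : ∃ z ∈ Set.Icc z1 z2, G z ≠ 0)
    (hnz' : ∃ z ∈ Set.Icc z1 z2, G' z ≠ 0) :
    0 < (z2 - z1)⁻¹ * ((∫ z in z1..z2, G z ^ 2) + γ1 * G z1 ^ 2) ∨
    0 < (z2 - z1)⁻¹ * ((∫ z in z1..z2, G' z ^ 2) + γ1 * G' z1 ^ 2) := by
  have hH : 0 < (z2 - z1)⁻¹ := inv_pos.2 (sub_pos.2 hz)
  simp only [mul_pos_iff_of_pos_left hH, pow_two]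
  by_contra! ⟨hle, hle'⟩
  have hlt := norm_neg_of_norm_nonpos hz hS hSpos hk hγ hG hode hbc1 hbc2 hnz hle
  have hG1' := left_ne_zero_of_norm_nonpos hz hG'.continuous hnz' hle'
  have horth : (∫ z in z1..z2, G z * G' z) + γ1 * (G z1 * G' z1) = 0 := by
    have h := eigenvalue_mul_inner_eq_energy hz hS hSpos hγ.ne hG (hG'.of_le one_le_two)
      hode hbc1 hbc2
    have h' := eigenvalue_mul_inner_eq_energy hz hS hSpos hγ.ne hG' (hG.of_le one_le_two)
      hode' hbc1' hbc2'
    simp only [mul_comm (G' _) (G _), mul_comm (deriv G' _) (deriv G _)] at h'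
    exact (mul_eq_zero.1 (by linear_combination h - h' :
      (lam - lam') * ((∫ z in z1..z2, G z * G' z) + γ1 * (G z1 * G' z1)) = 0)).resolve_left
      (sub_ne_zero.2 hne)
  -- `G' z1 • G - G z1 • G'` vanishes at `z1`, so its indefinite norm is nonnegative.
  have hcomb : 0 ≤ ∫ z in z1..z2, (G' z1 * G z - G z1 * G' z) ^ 2 :=
    intervalIntegral.integral_nonneg hz.le fun z _ => sq_nonneg _
  have hGG : IntervalIntegrable (fun z => G z * G z) MeasureTheory.volume z1 z2 :=
    (hG.continuous.mul hG.continuous).intervalIntegrable _ _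
  have hGG' : IntervalIntegrable (fun z => G z * G' z) MeasureTheory.volume z1 z2 :=
    (hG.continuous.mul hG'.continuous).intervalIntegrable _ _
  have hG'G' : IntervalIntegrable (fun z => G' z * G' z) MeasureTheory.volume z1 z2 :=
    (hG'.continuous.mul hG'.continuous).intervalIntegrable _ _
  have hexp : (∫ z in z1..z2, (G' z1 * G z - G z1 * G' z) ^ 2) =
      G' z1 ^ 2 * (∫ z in z1..z2, G z * G z) - 2 * G' z1 * G z1 * (∫ z in z1..z2, G z * G' z) +
        G z1 ^ 2 * (∫ z in z1..z2, G' z * G' z) := by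
    rw [← intervalIntegral.integral_const_mul, ← intervalIntegral.integral_const_mul,
      ← intervalIntegral.integral_const_mul,
      ← intervalIntegral.integral_sub (hGG.const_mul _) (hGG'.const_mul _),
      ← intervalIntegral.integral_add ((hGG.const_mul _).sub (hGG'.const_mul _))
        (hG'G'.const_mul _)]
    congr 1
    ext z
    ring
  have hneg := mul_neg_of_pos_of_neg (sq_pos_of_ne_zero hG1') hlt
  have hnonpos := mul_nonpos_of_nonneg_of_nonpos (sq_nonneg (G z1)) hle'
  have hcross : G' z1 * G z1 * ((∫ z in z1..z2, G z * G' z) + γ1 * (G z1 * G' z1)) = 0 := by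
    rw [horth, mul_zero]
  linarith
end
end

section
/- (Detailed energy conservation for triad interactions with isentropic boundaries.) For any such data, Σ_{a ∈ ℤ²} Σ_{k ∈ ℤ²} Σ_{l=0}^{N} Σ_{m=0}^{N} Σ_{n=0}^{N} ( −(a × k) ) · ε(l,m,n) · Re( ψ(a,l) · q(k−a, m) · conj(ψ(k,n)) ) = 0, where all sums are finite because ψ is finitely supported. (This is the identity showing that the nonlinear interaction term in the modal energy equation vanishes, so any modal truncation with isentropic boundaries conserves the truncated energy.) -/
open Filter Topology

noncomputable section

/-- A finitely supported double sum vanishes if its summand is odd under `(x, y) ↦ (-y, -x)`. -/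
theorem finsum_finsum_eq_zero_of_neg_swap {G : Type*} [AddGroup G] (f : G → G → ℝ)
    (hf : (Function.support (Function.uncurry f)).Finite)
    (hodd : ∀ x y, f (-y) (-x) = -f x y) : ∑ᶠ x, ∑ᶠ y, f x y = 0 := by
  have hcurry := finsum_curry (Function.uncurry f) hf
  simp only [Function.uncurry_apply_pair] at hcurry
  rw [← hcurry]
  have hcomp := finsum_comp_equiv ((Equiv.prodComm G G).trans ((Equiv.neg G).prodCongr (Equiv.neg G)))
    (f := Function.uncurry f)
  have hneg : ∑ᶠ p, -Function.uncurry f p = ∑ᶠ p, Function.uncurry f p := by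
    rw [← hcomp]
    exact finsum_congr fun p => (hodd p.1 p.2).symm
  rw [finsum_neg_distrib] at hneg
  linarith

/-- **detailed energy conservation for triad interactions with
isentropic boundaries.** For a finitely supported, real (in physical space)
modal field `ψ`, a fully symmetric vertical coupling coefficient
`ε(l,m,n) = ε(n,m,l)`, and `q(k,m) = −(|k|² + λ(m)) ψ(k,m)`, the total
nonlinear energy transfer vanishes:
`Σ_a Σ_k Σ_{l,m,n} (−(a×k)) ε(l,m,n) Re(ψ(a,l) q(k−a,m) conj(ψ(k,n))) = 0`. -/
theorem statement_18 (N : ℕ) (lam : Fin (N + 1) → ℝ)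
    (eps : Fin (N + 1) → Fin (N + 1) → Fin (N + 1) → ℝ)
    (heps : ∀ l m n, eps l m n = eps n m l)
    (ψ : ℤ × ℤ → Fin (N + 1) → ℂ)
    (hsupp : (Function.support ψ).Finite)
    (hreal : ∀ (kk : ℤ × ℤ) (n : Fin (N + 1)), ψ (-kk) n = (starRingEnd ℂ) (ψ kk n)) :
    (∑ᶠ a : ℤ × ℤ, ∑ᶠ kk : ℤ × ℤ, ∑ l : Fin (N + 1), ∑ m : Fin (N + 1),
      ∑ n : Fin (N + 1),
        (-((a.1 * kk.2 - a.2 * kk.1 : ℤ) : ℝ)) * eps l m n *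
          (ψ a l *
            (-((((kk - a).1 ^ 2 + (kk - a).2 ^ 2 : ℤ) : ℂ) + (lam m : ℂ)) *
              ψ (kk - a) m) *
            (starRingEnd ℂ) (ψ kk n)).re) = 0 := by
  apply finsum_finsum_eq_zero_of_neg_swap
  · refine (hsupp.prod hsupp).subset fun p hp => ?_
    simp only [Set.mem_prod, Function.mem_support]
    refine ⟨fun h => hp ?_, fun h => hp ?_⟩ <;> simp [Function.uncurry, h]
  · intro a kk
    simp only [← Finset.sum_neg_distrib]
    conv_lhs =>
      enter [2, l]
      rw [Finset.sum_comm]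
    rw [Finset.sum_comm]
    refine Finset.sum_congr rfl fun l _ => ?_
    rw [Finset.sum_comm]
    refine Finset.sum_congr rfl fun m _ => Finset.sum_congr rfl fun n _ => ?_
    rw [heps n m l, hreal kk, hreal a, Complex.conj_conj, show -a - -kk = kk - a by abel,
      mul_comm (_ * _) (ψ a l), mul_comm ((starRingEnd ℂ) (ψ kk n)), ← mul_assoc (ψ a l)]
    simp only [Prod.fst_neg, Prod.snd_neg]
    push_cast
    ring
end
end

section
/- (Inversion function for a piecewise-constant stratification.) Suppose Ψ : (−∞,0] → ℝ is continuous, tends to 0 as z → −∞, is twice continuously differentiable on (−∞,−h) and on (−h,0) with one-sided derivatives existing at −h and at 0, satisfies Ψ″(z) = σ₀² k² Ψ(z) for z ∈ (−h,0) and Ψ″(z) = σ_pyc² k² Ψ(z) for z ∈ (−∞,−h), satisfies the flux-matching condition σ₀^{−2} Ψ′(−h⁺) = σ_pyc^{−2} Ψ′(−h⁻), and satisfies Ψ(0) = 1. Then such a function Ψ exists and is unique, and its surface derivative satisfies σ₀^{−2} Ψ′(0⁻) = (k/σ₀) · [ cosh(σ₀ h k) + (σ_pyc/σ₀) sinh(σ₀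 h k) ] / [ sinh(σ₀ h k) + (σ_pyc/σ₀) cosh(σ₀ h k) ]. -/
open Filter Topology

noncomputable section

/-- The decaying vertical structure function of surface quasigeostrophic
theory for the piecewise-constant stratification `σ = σ0` on `(−h,0]`,
`σ = σp` on `(−∞,−h]`, at horizontal wavenumber `k`: continuous on
`(−∞,0]`, decaying at `−∞`, normalized by `Ψ(0) = 1`, twice continuously
differentiable on each layer with one-sided derivatives at `−h` and `0`,
satisfying `Ψ″ = σ0²k²Ψ` in the upper layer, `Ψ″ = σp²k²Ψ` in the lower
layer, and the flux-matching condition `σ0⁻²Ψ′(−h⁺) = σp⁻²Ψ′(−h⁻)`. -/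
def IsSQGProfile (σ0 σp h k : ℝ) (Ψ : ℝ → ℝ) : Prop :=
  ContinuousOn Ψ (Set.Iic 0) ∧
  Tendsto Ψ atBot (nhds 0) ∧
  Ψ 0 = 1 ∧
  ∃ du dd : ℝ → ℝ,
    (∀ z ∈ Set.Ioo (-h) 0, HasDerivAt Ψ (du z) z) ∧
    (∀ z ∈ Set.Iio (-h), HasDerivAt Ψ (dd z) z) ∧
    HasDerivWithinAt Ψ (du (-h)) (Set.Icc (-h) 0) (-h) ∧
    HasDerivWithinAt Ψ (du 0) (Set.Icc (-h) 0) 0 ∧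
    HasDerivWithinAt Ψ (dd (-h)) (Set.Iic (-h)) (-h) ∧
    (∀ z ∈ Set.Ioo (-h) 0, HasDerivAt du (σ0 ^ 2 * k ^ 2 * Ψ z) z) ∧
    (∀ z ∈ Set.Iio (-h), HasDerivAt dd (σp ^ 2 * k ^ 2 * Ψ z) z) ∧
    (σ0 ^ 2)⁻¹ * du (-h) = (σp ^ 2)⁻¹ * dd (-h)

/-- A solution of `f″ = a²f` on an open preconnected set is a combination of `e^{az}` and
`e^{-az}`. -/
lemma exists_eq_exp_add_exp_of_hasDerivAt {s : Set ℝ} (hs : IsOpen s) (hc : IsPreconnected s)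
    {a : ℝ} (ha : a ≠ 0) {f g : ℝ → ℝ} (hf : ∀ z ∈ s, HasDerivAt f (g z) z)
    (hg : ∀ z ∈ s, HasDerivAt g (a ^ 2 * f z) z) :
    ∃ P Q : ℝ, ∀ z ∈ s, f z = P * Real.exp (a * z) + Q * Real.exp (-(a * z)) := by
  have key : ∀ c : ℝ, c ^ 2 = a ^ 2 →
      ∃ p : ℝ, ∀ z ∈ s, (g z + c * f z) * Real.exp (-(c * z)) = p := by
    intro c hca
    have hd : ∀ z ∈ s, HasDerivAt (fun z => (g z + c * f z) * Real.exp (-(c * z))) 0 z := by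
      intro z hz
      have he : HasDerivAt (fun z => Real.exp (-(c * z))) (Real.exp (-(c * z)) * -(c * 1)) z :=
        (((hasDerivAt_id z).const_mul c).neg).exp
      refine (((hg z hz).add ((hf z hz).const_mul c)).mul he).congr_deriv ?_
      rw [← hca]
      simp only [Pi.add_apply]
      ring
    exact hs.exists_is_const_of_deriv_eq_zero hc
      (fun z hz => (hd z hz).differentiableAt.differentiableWithinAt)
      (fun z hz => (hd z hz).deriv)
  obtain ⟨p, hp⟩ := key a rfl
  obtain ⟨q, hq⟩ := key (-a) (by ring)
  refine ⟨p / (2 * a), -q / (2 * a), fun z hz => ?_⟩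
  rw [← hp z hz, ← hq z hz, show -(-a * z) = a * z by ring, Real.exp_neg]
  have := Real.exp_ne_zero (a * z)
  field_simp
  ring

lemma hasDerivAt_exp_add_exp (a P Q z : ℝ) :
    HasDerivAt (fun z => P * Real.exp (a * z) + Q * Real.exp (-(a * z)))
      (a * (P * Real.exp (a * z) - Q * Real.exp (-(a * z)))) z := by
  have h1 : HasDerivAt (fun z => a * z) (a * 1) z := (hasDerivAt_id z).const_mul a
  refine ((h1.exp.const_mul P).add (h1.neg.exp.const_mul Q)).congr_deriv ?_
  simp only [Pi.neg_apply]
  ring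

lemma hasDerivAt_exp_sub_exp (a P Q z : ℝ) :
    HasDerivAt (fun z => a * (P * Real.exp (a * z) - Q * Real.exp (-(a * z))))
      (a ^ 2 * (P * Real.exp (a * z) + Q * Real.exp (-(a * z)))) z := by
  have h := (hasDerivAt_exp_add_exp a P (-Q) z).const_mul a
  refine (h.congr_deriv (by ring)).congr_of_eventuallyEq (Eventually.of_forall fun y => ?_)
  ring

/-- A combination of `e^{bz}` and `e^{-bz}` that decays at `−∞` has no `e^{-bz}` component. -/
lemma eq_zero_of_tendsto_exp_add_exp {b P Q : ℝ} (hb : 0 < b)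
    (h : Tendsto (fun z => P * Real.exp (b * z) + Q * Real.exp (-(b * z))) atBot (𝓝 0)) :
    Q = 0 := by
  have hE : Tendsto (fun z => Real.exp (b * z)) atBot (𝓝 0) :=
    Real.tendsto_exp_atBot.comp (tendsto_id.const_mul_atBot hb)
  have h2 := (h.mul hE).sub ((hE.mul hE).const_mul P)
  have h3 : (fun z => (P * Real.exp (b * z) + Q * Real.exp (-(b * z))) * Real.exp (b * z)
      - P * (Real.exp (b * z) * Real.exp (b * z))) = fun _ => Q := by
    funext z
    rw [Real.exp_neg]
    have := Real.exp_ne_zero (b * z)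
    field_simp
    ring
  rw [h3] at h2
  simpa using tendsto_nhds_unique tendsto_const_nhds h2

/-- The explicit form of a vertical structure function in both layers, with the matching
conditions on its coefficients. -/
lemma IsSQGProfile.exists_coeff {σ0 σp h k : ℝ} {Ψ : ℝ → ℝ} (hΨ : IsSQGProfile σ0 σp h k Ψ)
    (hσ0 : 0 < σ0) (hσp : 0 < σp) (hh : 0 < h) (hk : 0 < k) :
    ∃ P Q : ℝ,
      (∀ z ∈ Set.Icc (-h) 0,
        Ψ z = P * Real.exp (σ0 * k * z) + Q * Real.exp (-(σ0 * k * z))) ∧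
      (∀ z ∈ Set.Iic (-h), Ψ z = Ψ (-h) * Real.exp (σp * k * (z + h))) ∧
      P + Q = 1 ∧
      P * (σp - σ0) * Real.exp (-(σ0 * h * k)) = Q * (σp + σ0) * Real.exp (σ0 * h * k) := by
  obtain ⟨hcont, hlim, h0, du, dd, hu, hd, hu1, -, hd1, hu2, hd2, hflux⟩ := hΨ
  have ha : 0 < σ0 * k := mul_pos hσ0 hk
  have hb : 0 < σp * k := mul_pos hσp hk
  obtain ⟨P, Q, hPQ⟩ := exists_eq_exp_add_exp_of_hasDerivAt isOpen_Ioo isPreconnected_Ioo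
    ha.ne' hu (fun z hz => (hu2 z hz).congr_deriv (by ring))
  obtain ⟨R, S, hRS⟩ := exists_eq_exp_add_exp_of_hasDerivAt isOpen_Iio isPreconnected_Iio
    hb.ne' hd (fun z hz => (hd2 z hz).congr_deriv (by ring))
  have hS : S = 0 := by
    refine eq_zero_of_tendsto_exp_add_exp (P := R) hb (hlim.congr' ?_)
    filter_upwards [eventually_lt_atBot (-h)] with z hz using hRS z hz
  subst hS
  have hup : Set.EqOn Ψ (fun z => P * Real.exp (σ0 * k * z) + Q * Real.exp (-(σ0 * k * z)))
      (Set.Icc (-h) 0) := by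
    refine Set.EqOn.of_subset_closure (s := Set.Ioo (-h) 0) hPQ
      (hcont.mono Set.Icc_subset_Iic_self) (by fun_prop) Set.Ioo_subset_Icc_self ?_
    rw [closure_Ioo (by linarith)]
  have hlow : Set.EqOn Ψ (fun z => R * Real.exp (σp * k * z) + 0 * Real.exp (-(σp * k * z)))
      (Set.Iic (-h)) := by
    refine Set.EqOn.of_subset_closure (s := Set.Iio (-h)) hRS
      (hcont.mono (Set.Iic_subset_Iic.2 (by linarith))) (by fun_prop) Set.Iio_subset_Iic_self ?_
    rw [closure_Iio]
  have hmemu : -h ∈ Set.Icc (-h) 0 := ⟨le_rfl, by linarith⟩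
  have hmemd : -h ∈ Set.Iic (-h) := Set.mem_Iic.2 le_rfl
  have eu := (uniqueDiffOn_Icc (by linarith : -h < 0) _ hmemu).eq_deriv _ hu1
    ((hasDerivAt_exp_add_exp (σ0 * k) P Q (-h)).hasDerivWithinAt.congr hup (hup hmemu))
  have ed := (uniqueDiffOn_Iic (-h) _ hmemd).eq_deriv _ hd1
    ((hasDerivAt_exp_add_exp (σp * k) R 0 (-h)).hasDerivWithinAt.congr hlow (hlow hmemd))
  have vu := hup hmemu
  have vd := hlow hmemd
  have v0 := hup (⟨by linarith, le_rfl⟩ : (0 : ℝ) ∈ Set.Icc (-h) 0)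
  simp only [zero_mul, add_zero, sub_zero] at vd ed
  refine ⟨P, Q, hup, fun z hz => ?_, by simpa [h0] using v0.symm, ?_⟩
  · rw [hlow hz, vd, mul_assoc, ← Real.exp_add]
    ring_nf
  · rw [← vd] at ed
    rw [eu, ed, vu] at hflux
    rw [show -(σ0 * k * -h) = σ0 * h * k by ring, show σ0 * k * -h = -(σ0 * h * k) by ring]
      at hflux
    field_simp at hflux
    rw [mul_right_comm σ0 k h] at hflux
    linarith

/-- The denominator of the inversion function, in exponential form, is positive. -/
lemma sub_mul_exp_neg_add_pos {σ0 σp x : ℝ} (hσ0 : 0 < σ0) (hσp : 0 < σp) (hx : 0 < x) :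
    0 < (σp - σ0) * Real.exp (-x) + (σp + σ0) * Real.exp x := by
  have h1 : Real.exp (-x) < Real.exp x := Real.exp_lt_exp.2 (by linarith)
  nlinarith [mul_pos hσp (Real.exp_pos (-x)), mul_pos hσp (Real.exp_pos x),
    mul_pos hσ0 (sub_pos.2 h1)]

lemma isSQGProfile_of_coeff {σ0 σp h k P Q : ℝ}
    (hσ0 : 0 < σ0) (hσp : 0 < σp) (hh : 0 < h) (hk : 0 < k) (hsum : P + Q = 1)
    (hPQ : P * (σp - σ0) * Real.exp (-(σ0 * h * k)) =
      Q * (σp + σ0) * Real.exp (σ0 * h * k)) :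
    IsSQGProfile σ0 σp h k fun z => if z ≤ -h
      then (P * Real.exp (-(σ0 * h * k)) + Q * Real.exp (σ0 * h * k)) * Real.exp (σp * k * h)
        * Real.exp (σp * k * z) + 0 * Real.exp (-(σp * k * z))
      else P * Real.exp (σ0 * k * z) + Q * Real.exp (-(σ0 * k * z)) := by
  set R := (P * Real.exp (-(σ0 * h * k)) + Q * Real.exp (σ0 * h * k)) * Real.exp (σp * k * h)
    with hR
  have hb : 0 < σp * k := mul_pos hσp hk
  have hRe : R * Real.exp (σp * k * -h) =
      P * Real.exp (-(σ0 * h * k)) + Q * Real.exp (σ0 * h * k) := by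
    rw [hR, mul_assoc, ← Real.exp_add, show σp * k * h + σp * k * -h = 0 by ring]
    simp
  have e2 : σ0 * k * -h = -(σ0 * h * k) := by ring
  set low : ℝ → ℝ := fun z => R * Real.exp (σp * k * z) + 0 * Real.exp (-(σp * k * z)) with hlow
  set up : ℝ → ℝ := fun z => P * Real.exp (σ0 * k * z) + Q * Real.exp (-(σ0 * k * z)) with hup
  set Ψ : ℝ → ℝ := fun z => if z ≤ -h then low z else up z with hΨ
  have hjoin : low (-h) = up (-h) := by
    simp only [hlow, hup, zero_mul, add_zero, hRe, e2, neg_neg]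
  have Elow : Set.EqOn Ψ low (Set.Iic (-h)) := fun z hz => if_pos hz
  have Eup : Set.EqOn Ψ up (Set.Ici (-h)) := by
    intro z hz
    rcases eq_or_lt_of_le (Set.mem_Ici.1 hz) with rfl | hz'
    · exact (if_pos le_rfl).trans hjoin
    · exact if_neg (not_le.2 hz')
  have Eup' : Set.EqOn Ψ up (Set.Icc (-h) 0) := Eup.mono Set.Icc_subset_Ici_self
  have hmem0 : (0 : ℝ) ∈ Set.Icc (-h) 0 := ⟨by linarith, le_rfl⟩
  have hmemu : -h ∈ Set.Icc (-h) 0 := ⟨le_rfl, by linarith⟩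
  have hmemd : -h ∈ Set.Iic (-h) := Set.mem_Iic.2 le_rfl
  refine ⟨?_, ?_, ?_, fun z => σ0 * k * (P * Real.exp (σ0 * k * z) - Q * Real.exp (-(σ0 * k * z))),
    fun z => σp * k * (R * Real.exp (σp * k * z) - 0 * Real.exp (-(σp * k * z))),
    ?_, ?_, ?_, ?_, ?_, ?_, ?_, ?_⟩
  · refine (Continuous.if_le (by fun_prop) (by fun_prop) continuous_id continuous_const
      ?_).continuousOn
    rintro z rfl
    exact hjoin
  · have hE : Tendsto (fun z => R * Real.exp (σp * k * z)) atBot (𝓝 (R * 0)) :=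
      (Real.tendsto_exp_atBot.comp (tendsto_id.const_mul_atBot hb)).const_mul R
    rw [mul_zero] at hE
    refine hE.congr' ?_
    filter_upwards [eventually_le_atBot (-h)] with z hz
    rw [Elow hz]
    simp [hlow]
  · rw [Eup' hmem0]
    simpa [hup] using hsum
  · intro z hz
    exact (hasDerivAt_exp_add_exp _ _ _ z).congr_of_eventuallyEq
      (Eup.eventuallyEq_of_mem (Ici_mem_nhds hz.1))
  · intro z hz
    exact (hasDerivAt_exp_add_exp _ _ _ z).congr_of_eventuallyEq
      (Elow.eventuallyEq_of_mem (Iic_mem_nhds hz))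
  · exact (hasDerivAt_exp_add_exp _ _ _ _).hasDerivWithinAt.congr Eup' (Eup' hmemu)
  · exact (hasDerivAt_exp_add_exp _ _ _ _).hasDerivWithinAt.congr Eup' (Eup' hmem0)
  · exact (hasDerivAt_exp_add_exp _ _ _ _).hasDerivWithinAt.congr Elow (Elow hmemd)
  · intro z hz
    rw [Eup (Set.mem_Ici.2 hz.1.le)]
    exact (hasDerivAt_exp_sub_exp _ _ _ z).congr_deriv (by ring)
  · intro z hz
    rw [Elow (Set.mem_Iic.2 (Set.mem_Iio.1 hz).le)]
    exact (hasDerivAt_exp_sub_exp _ _ _ z).congr_deriv (by ring)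
  · simp only [zero_mul, sub_zero, hRe, e2, neg_neg]
    field_simp
    rw [mul_right_comm σ0 k h]
    linarith

/-- **inversion function for piecewise-constant
stratification.** For positive `σ0, σp, h, k`, the decaying vertical
structure function `Ψ` exists, is unique on `(−∞,0]`, and its (one-sided)
surface derivative satisfies
`σ0⁻² Ψ′(0⁻) = (k/σ0)·[cosh(σ0 h k) + (σp/σ0) sinh(σ0 h k)] /
[sinh(σ0 h k) + (σp/σ0) cosh(σ0 h k)]`. -/
theorem statement_19 (σ0 σp h k : ℝ)
    (hσ0 : 0 < σ0) (hσp : 0 < σp) (hh : 0 < h) (hk : 0 < k) :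
    (∃ Ψ : ℝ → ℝ, IsSQGProfile σ0 σp h k Ψ) ∧
    (∀ Ψ Ψ₂ : ℝ → ℝ, IsSQGProfile σ0 σp h k Ψ → IsSQGProfile σ0 σp h k Ψ₂ →
      Set.EqOn Ψ Ψ₂ (Set.Iic 0)) ∧
    (∀ Ψ : ℝ → ℝ, IsSQGProfile σ0 σp h k Ψ →
      ∀ d : ℝ, HasDerivWithinAt Ψ d (Set.Icc (-h) 0) 0 →
        (σ0 ^ 2)⁻¹ * d =
          (k / σ0) *
            ((Real.cosh (σ0 * h * k) + (σp / σ0) * Real.sinh (σ0 * h * k)) /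
              (Real.sinh (σ0 * h * k) + (σp / σ0) * Real.cosh (σ0 * h * k)))) := by
  have hx : 0 < σ0 * h * k := by positivity
  have hW := sub_mul_exp_neg_add_pos hσ0 hσp hx
  refine ⟨?_, ?_, ?_⟩
  · refine ⟨_, isSQGProfile_of_coeff
      (P := (σp + σ0) * Real.exp (σ0 * h * k) /
        ((σp - σ0) * Real.exp (-(σ0 * h * k)) + (σp + σ0) * Real.exp (σ0 * h * k)))
      (Q := (σp - σ0) * Real.exp (-(σ0 * h * k)) /
        ((σp - σ0) * Real.exp (-(σ0 * h * k)) + (σp + σ0) * Real.exp (σ0 * h * k)))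
      hσ0 hσp hh hk ?_ (by ring)⟩
    rw [← add_div, add_comm, div_self hW.ne']
  · intro Ψ Ψ₂ h₁ h₂
    obtain ⟨P, Q, hup, hlow, hsum, hPQ⟩ := h₁.exists_coeff hσ0 hσp hh hk
    obtain ⟨P₂, Q₂, hup₂, hlow₂, hsum₂, hPQ₂⟩ := h₂.exists_coeff hσ0 hσp hh hk
    obtain rfl : Q = 1 - P := by linarith
    obtain rfl : Q₂ = 1 - P₂ := by linarith
    obtain rfl : P = P₂ := by
      refine mul_right_cancel₀ hW.ne' ?_
      linear_combination hPQ - hPQ₂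
    have hE : Set.EqOn Ψ Ψ₂ (Set.Icc (-h) 0) := fun z hz => (hup z hz).trans (hup₂ z hz).symm
    intro z hz
    rcases le_total z (-h) with hzh | hzh
    · rw [hlow z hzh, hlow₂ z hzh, hE ⟨le_rfl, by linarith⟩]
    · exact hE ⟨hzh, hz⟩
  · intro Ψ hΨ d hd
    obtain ⟨P, Q, hup, -, hsum, hPQ⟩ := hΨ.exists_coeff hσ0 hσp hh hk
    have hmem0 : (0 : ℝ) ∈ Set.Icc (-h) 0 := ⟨by linarith, le_rfl⟩
    have ed := (uniqueDiffOn_Icc (by linarith : -h < 0) _ hmem0).eq_deriv _ hd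
      ((hasDerivAt_exp_add_exp (σ0 * k) P Q 0).hasDerivWithinAt.congr hup (hup 0 hmem0))
    simp only [mul_zero, neg_zero, Real.exp_zero, mul_one] at ed
    obtain rfl : Q = 1 - P := by linarith
    have hratio : (Real.cosh (σ0 * h * k) + (σp / σ0) * Real.sinh (σ0 * h * k)) /
        (Real.sinh (σ0 * h * k) + (σp / σ0) * Real.cosh (σ0 * h * k)) = P - (1 - P) := by
      have hden : Real.sinh (σ0 * h * k) + (σp / σ0) * Real.cosh (σ0 * h * k) =
          ((σp - σ0) * Real.exp (-(σ0 * h * k)) + (σp + σ0) * Real.exp (σ0 * h * k)) /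
            (2 * σ0) := by
        rw [Real.sinh_eq, Real.cosh_eq]
        field_simp
        ring
      rw [hden, div_eq_iff (by positivity), Real.sinh_eq, Real.cosh_eq]
      field_simp
      linear_combination -2 * hPQ
    rw [hratio, ed]
    field_simp
end
end
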